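/- Let n ≥ 2 and δ ∈ (0,1). For ε ∈ (0,1) set U_ε = B_1 \ closure(B_{1−ε}) ⊂ ℝ^{2n}. Then the function ε ↦ c_δ(U_ε) from (0,1) to [0,∞] is discontinuous at ε = δ. -/

import Mathlib

open Metric Set MeasureTheory Real Filter Topology Bornology
open scoped ContDiff ENNReal

noncomputable section

/-- `ℝ^{2n}` with the Euclidean structure. -/
abbrev R2n (n : ℕ) := EuclideanSpace ℝ (Fin (2 * n))

/-- The standard symplectic form `ω_st = Σ dx_i ∧ dy_i` on `ℝ^{2n}`,
evaluated on a pair of (tangent) vectors. -/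
def sympForm (n : ℕ) (v w : R2n n) : ℝ :=
  ∑ i : Fin n,
    (v ⟨2 * i.1, by have := i.isLt; omega⟩ * w ⟨2 * i.1 + 1, by have := i.isLt; omega⟩ -
      v ⟨2 * i.1 + 1, by have := i.isLt; omega⟩ * w ⟨2 * i.1, by have := i.isLt; omega⟩)

/-- `φ` is a symplectic embedding of the open set `N ⊆ ℝ^{2n}` into `U ⊆ ℝ^{2n}`:
a smooth injective map on `N` with image in `U` whose derivative preserves `ω_st`. -/
def IsSympEmbOn (n : ℕ) (N U : Set (R2n n)) (φ : R2n n → R2n n) : Prop :=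
  IsOpen N ∧ ContDiffOn ℝ ∞ φ N ∧ InjOn φ N ∧ MapsTo φ N U ∧
    ∀ p ∈ N, ∀ v w : R2n n,
      sympForm n (fderiv ℝ φ p v) (fderiv ℝ φ p w) = sympForm n v w

/-- A symplectic embedding of (a neighbourhood of) an arbitrary set `A ⊆ ℝ^{2n}` into `U`. -/
def SympEmbNbhd (n : ℕ) (A U : Set (R2n n)) : Prop :=
  ∃ N φ, A ⊆ N ∧ IsSympEmbOn n N U φ

/-- The spherical capacity `s(U)`. -/
def sphericalCap (n : ℕ) (U : Set (R2n n)) : ℝ≥0∞ :=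
  sSup {c : ℝ≥0∞ | ∃ r : ℝ, 0 < r ∧ c = ENNReal.ofReal (π * r ^ 2) ∧
    SympEmbNbhd n (sphere (0 : R2n n) r) U}

/-- The quadratic form defining the ellipsoid with symplectic half axes `a i`. -/
def ellQ (n : ℕ) (a : Fin n → ℝ) (z : R2n n) : ℝ :=
  ∑ i : Fin n,
    ((z ⟨2 * i.1, by have := i.isLt; omega⟩) ^ 2 +
      (z ⟨2 * i.1 + 1, by have := i.isLt; omega⟩) ^ 2) / (a i) ^ 2

/-- The open ellipsoid `E(a 0, …, a (n-1)) ⊆ ℝ^{2n}`. -/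
def ellipsoid (n : ℕ) (a : Fin n → ℝ) : Set (R2n n) := {z | ellQ n a z < 1}

/-- The boundary `∂E(a 0, …, a (n-1)) ⊆ ℝ^{2n}` of an ellipsoid. -/
def ellipsoidBdry (n : ℕ) (a : Fin n → ℝ) : Set (R2n n) := {z | ellQ n a z = 1}

/-- The ellipsoidal shell `U_ε = (1+ε)E \ closure((1-ε)E)`. -/
def ellShell (n : ℕ) (a : Fin n → ℝ) (ε : ℝ) : Set (R2n n) :=
  ellipsoid n (fun i => (1 + ε) * a i) \ closure (ellipsoid n (fun i => (1 - ε) * a i))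

/-- The `δ`-shell capacity `c_δ(U)`, defined via embeddings of the closed
shells `r A_δ = closure(B_r) \ B_{r(1-δ)}`. -/
def shellCap (n : ℕ) (δ : ℝ) (U : Set (R2n n)) : ℝ≥0∞ :=
  sSup {c : ℝ≥0∞ | ∃ r : ℝ, 0 < r ∧ c = ENNReal.ofReal (π * r ^ 2) ∧
    SympEmbNbhd n (closedBall (0 : R2n n) r \ ball 0 (r * (1 - δ))) U}

/-- The ellipsoidal capacity `e(U)`: the supremum of `π r₁²` over symplectic embeddings of
boundaries of ellipsoids with half axes `r₁ ≤ … ≤ r_n` (here `r₁ = ⨅ i, a i`). -/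
def ellipsoidalCap (n : ℕ) (U : Set (R2n n)) : ℝ≥0∞ :=
  sSup {c : ℝ≥0∞ | ∃ a : Fin n → ℝ, (∀ i, 0 < a i) ∧ Monotone a ∧
    c = ENNReal.ofReal (π * (⨅ i, a i) ^ 2) ∧ SympEmbNbhd n (ellipsoidBdry n a) U}

/-- The Gromov radius `c_B(U)`. -/
def gromovRadius (n : ℕ) (U : Set (R2n n)) : ℝ≥0∞ :=
  sSup {c : ℝ≥0∞ | ∃ r : ℝ, 0 < r ∧ c = ENNReal.ofReal (π * r ^ 2) ∧
    ∃ φ, IsSympEmbOn n (ball (0 : R2n n) r) U φ}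

/-- The `j`-th partial derivative of a function on Euclidean space. -/
def partialD {ι : Type*} [Fintype ι] [DecidableEq ι] (j : ι) (f : EuclideanSpace ℝ ι → ℝ)
    (x : EuclideanSpace ℝ ι) : ℝ :=
  fderiv ℝ f x (EuclideanSpace.single j 1)

/-- The Jacobian matrix of a tuple of functions; row `k` is the gradient of `f k`. -/
def jacobian {ι : Type*} [Fintype ι] [DecidableEq ι] (f : ι → EuclideanSpace ℝ ι → ℝ)
    (x : EuclideanSpace ℝ ι) : Matrix ι ι ℝ :=
  Matrix.of fun k j => partialD j (f k) x

section Piola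

variable {ι : Type*} [Fintype ι] [DecidableEq ι]

lemma contDiff_partialD {f : EuclideanSpace ℝ ι → ℝ} (hf : ContDiff ℝ ∞ f) (j : ι) :
    ContDiff ℝ ∞ (partialD j f) :=
  (hf.fderiv_right (m := ∞) (by simp)).clm_apply contDiff_const

lemma partialD_comm {f : EuclideanSpace ℝ ι → ℝ} (hf : ContDiff ℝ ∞ f) (j l : ι)
    (x : EuclideanSpace ℝ ι) :
    partialD j (partialD l f) x = partialD l (partialD j f) x := by
  have hd : DifferentiableAt ℝ (fderiv ℝ f) x :=
    ((hf.fderiv_right (m := ∞) (by simp)).differentiable (by simp)) x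
  have h : ∀ a b : ι, partialD a (partialD b f) x =
      fderiv ℝ (fderiv ℝ f) x (EuclideanSpace.single a 1) (EuclideanSpace.single b 1) := by
    intro a b
    unfold partialD
    rw [fderiv_clm_apply hd (by fun_prop)]
    simp
  rw [h, h]
  have := (hf.contDiffAt (x := x)).isSymmSndFDerivAt (by simp only [minSmoothness_of_isRCLikeNormedField]; exact WithTop.coe_le_coe.2 le_top)
  exact this _ _

/-- The determinant as a continuous multilinear function of the rows. -/
def detRows (ι : Type*) [Fintype ι] [DecidableEq ι] :
    ContinuousMultilinearMap ℝ (fun _ : ι => ι → ℝ) ℝ :=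
  ⟨Matrix.detRowAlternating.toMultilinearMap,
    (Continuous.matrix_det (A := fun m : ι → ι → ℝ => Matrix.of m) continuous_id)⟩

lemma partialD_det {N : EuclideanSpace ℝ ι → Matrix ι ι ℝ}
    (hN : ∀ k l, Differentiable ℝ fun x => N x k l) (j : ι) (x : EuclideanSpace ℝ ι) :
    partialD j (fun x => (N x).det) x =
      ∑ k, ((N x).updateRow k (fun l => partialD j (fun x => N x k l) x)).det := by
  have hrow : ∀ k, HasFDerivAt (fun x => (fun l => N x k l : ι → ℝ))
      (ContinuousLinearMap.pi fun l => fderiv ℝ (fun x => N x k l) x) x := by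
    intro k
    rw [hasFDerivAt_pi]
    intro l
    exact ((hN k l) x).hasFDerivAt
  have := HasFDerivAt.multilinear_comp (f := detRows ι) hrow
  unfold partialD
  have h2 : (fun x => (N x).det) = fun x => detRows ι (fun k l => N x k l) := rfl
  rw [h2, this.fderiv]
  simp only [sum_apply, ContinuousLinearMap.comp_apply]
  refine Finset.sum_congr rfl fun k _ => ?_
  rfl

lemma contDiff_det {N : EuclideanSpace ℝ ι → Matrix ι ι ℝ}
    (hN : ∀ k l, ContDiff ℝ ∞ fun x => N x k l) : ContDiff ℝ ∞ fun x => (N x).det := by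
  simp only [Matrix.det_apply]
  refine ContDiff.sum fun σ _ => ContDiff.const_smul _ ?_
  exact contDiff_prod fun i _ => hN _ _

lemma contDiff_jacobian {f : ι → EuclideanSpace ℝ ι → ℝ} (hf : ∀ k, ContDiff ℝ ∞ (f k)) (k l : ι) :
    ContDiff ℝ ∞ fun x => jacobian f x k l :=
  contDiff_partialD (hf k) l

lemma contDiff_updateRow {N : EuclideanSpace ℝ ι → Matrix ι ι ℝ}
    (hN : ∀ k l, ContDiff ℝ ∞ fun x => N x k l) {v : EuclideanSpace ℝ ι → ι → ℝ}
    (hv : ∀ l, ContDiff ℝ ∞ fun x => v x l) (i k l : ι) :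
    ContDiff ℝ ∞ fun x => ((N x).updateRow i (v x)) k l := by
  by_cases h : k = i
  · subst h; simpa using hv l
  · simpa [Matrix.updateRow_ne h] using hN k l

lemma det_updateRow_eq_sum (M : Matrix ι ι ℝ) (i : ι) (v : ι → ℝ) :
    (M.updateRow i v).det = ∑ j, v j * (M.updateRow i (Pi.single j 1)).det := by
  rw [Matrix.det_eq_sum_mul_adjugate_row _ i]
  simp [Matrix.adjugate_apply]

lemma det_updateRow_swap (M : Matrix ι ι ℝ) {i k : ι} (hk : k ≠ i) (v w : ι → ℝ) :
    ((M.updateRow i v).updateRow k w).det = -((M.updateRow i w).updateRow k v).det := by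
  have h : (M.updateRow i v).updateRow k w =
      ((M.updateRow i w).updateRow k v).submatrix (Equiv.swap i k) id := by
    ext a b
    by_cases h1 : a = k
    · subst h1; simp [Matrix.updateRow_ne hk.symm]
    by_cases h2 : a = i
    · subst h2; simp [Matrix.updateRow_ne hk.symm]
    · simp [Matrix.updateRow_ne h1, Matrix.updateRow_ne h2, Equiv.swap_apply_of_ne_of_ne h2 h1]
  rw [h, Matrix.det_permute, Equiv.Perm.sign_swap hk.symm]
  simp

/-- Piola's identity: the rows of the cofactor matrix of a Jacobian are divergence free. -/
lemma sum_partialD_cofactor_eq_zero {f : ι → EuclideanSpace ℝ ι → ℝ}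
    (hf : ∀ k, ContDiff ℝ ∞ (f k)) (i : ι) (x : EuclideanSpace ℝ ι) :
    ∑ j, partialD j (fun x => ((jacobian f x).updateRow i (Pi.single j 1)).det) x = 0 := by
  have h1 : ∀ j, partialD j (fun x => ((jacobian f x).updateRow i (Pi.single j 1)).det) x =
      ∑ k, ∑ l, if k = i then 0 else partialD j (partialD l (f k)) x *
        (((jacobian f x).updateRow i (Pi.single j 1)).updateRow k (Pi.single l 1)).det := by
    intro j
    rw [partialD_det (N := fun x => (jacobian f x).updateRow i (Pi.single j 1))]
    · refine Finset.sum_congr rfl fun k _ => ?_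
      by_cases hk : k = i
      · subst hk
        simp only [if_true, Finset.sum_const_zero]
        apply Matrix.det_eq_zero_of_row_eq_zero k
        intro l
        simp [partialD]
      · simp only [hk, if_false]
        rw [det_updateRow_eq_sum _ k]
        simp [Matrix.updateRow_ne hk, jacobian]
    · intro k l
      exact (contDiff_updateRow (contDiff_jacobian hf) (v := fun _ => Pi.single j 1) (fun l => contDiff_const) i k l).differentiable
        (by simp)
  simp only [h1]
  rw [Finset.sum_comm]
  refine Finset.sum_eq_zero fun k _ => ?_
  by_cases hk : k = i
  · simp [hk]
  simp only [hk, if_false]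
  set T : ι → ι → ℝ := fun j l => partialD j (partialD l (f k)) x *
        (((jacobian f x).updateRow i (Pi.single j 1)).updateRow k (Pi.single l 1)).det with hT
  have hanti : ∀ j l, T j l = - T l j := by
    intro j l
    simp only [hT]
    rw [partialD_comm (hf k) j l, ← mul_neg]
    congr 1
    exact det_updateRow_swap _ hk _ _
  have h2 : ∑ j, ∑ l, T j l = - ∑ j, ∑ l, T j l := by
    conv_lhs => rw [Finset.sum_comm]
    simp only [← Finset.sum_neg_distrib]
    exact Finset.sum_congr rfl fun j _ => Finset.sum_congr rfl fun l _ => hanti _ _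
  change ∑ j, ∑ l, T j l = 0
  linarith

lemma integral_partialD_mul {u v : EuclideanSpace ℝ ι → ℝ} (hu : ContDiff ℝ ∞ u)
    (hv : ContDiff ℝ ∞ v) (hc : HasCompactSupport u) (j : ι) :
    ∫ x, partialD j u x * v x = - ∫ x, u x * partialD j v x := by
  have hcd : HasCompactSupport (partialD j u) :=
    (hc.fderiv ℝ).comp_left (g := fun L : EuclideanSpace ℝ ι →L[ℝ] ℝ =>
      L (EuclideanSpace.single j 1)) (by simp)
  have := integral_mul_fderiv_eq_neg_fderiv_mul_of_integrable (μ := volume) (f := v) (g := u)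
    (v := EuclideanSpace.single j (1 : ℝ)) ?_ ?_ ?_ (fun x _ => hv.differentiable (by simp) x)
    (fun x _ => hu.differentiable (by simp) x)
  · simp only [partialD, mul_comm] at this ⊢
    exact this
  · exact ((contDiff_partialD hv j).continuous.mul hu.continuous).integrable_of_hasCompactSupport
      hc.mul_left
  · exact (hv.continuous.mul (contDiff_partialD hu j).continuous).integrable_of_hasCompactSupport
      hcd.mul_left
  · exact (hv.continuous.mul hu.continuous).integrable_of_hasCompactSupport hc.mul_left

lemma hasCompactSupport_partialD {u : EuclideanSpace ℝ ι → ℝ} (hc : HasCompactSupport u) (j : ι) :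
    HasCompactSupport (partialD j u) :=
  (hc.fderiv ℝ).comp_left (g := fun L : EuclideanSpace ℝ ι →L[ℝ] ℝ =>
      L (EuclideanSpace.single j 1)) (by simp)

/-- If `u` has compact support, then replacing a row of a Jacobian by the gradient of `u` gives a
determinant with zero integral. -/
theorem integral_det_updateRow_eq_zero {f : ι → EuclideanSpace ℝ ι → ℝ}
    (hf : ∀ k, ContDiff ℝ ∞ (f k)) (i : ι) {u : EuclideanSpace ℝ ι → ℝ} (hu : ContDiff ℝ ∞ u)
    (hc : HasCompactSupport u) :
    ∫ x, ((jacobian f x).updateRow i (fun j => partialD j u x)).det = 0 := by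
  have hcof : ∀ j, ContDiff ℝ ∞ fun x => ((jacobian f x).updateRow i (Pi.single j 1)).det :=
    fun j => contDiff_det (contDiff_updateRow (contDiff_jacobian hf) (v := fun _ => Pi.single j 1) (fun l => contDiff_const) i)
  simp only [det_updateRow_eq_sum _ i (fun j => partialD j u _)]
  rw [integral_finsetSum]
  · simp only [integral_partialD_mul hu (hcof _) hc]
    rw [Finset.sum_neg_distrib, ← integral_finsetSum]
    · simp only [← Finset.mul_sum, sum_partialD_cofactor_eq_zero hf, mul_zero, integral_zero, neg_zero]
    · intro j _
      exact (hu.continuous.mul (contDiff_partialD (hcof j) j).continuous).integrable_of_hasCompactSupport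
        hc.mul_right
  · intro j _
    exact ((contDiff_partialD hu j).continuous.mul (hcof j).continuous).integrable_of_hasCompactSupport
      (hasCompactSupport_partialD hc j).mul_right

end Piola

section Pushforward

variable {ι : Type*} [Fintype ι] [DecidableEq ι]

/-- The Jacobian determinant of a self-map of Euclidean space. -/
def jacDet (Φ : EuclideanSpace ℝ ι → EuclideanSpace ℝ ι) (x : EuclideanSpace ℝ ι) : ℝ :=
  (jacobian (fun k x => Φ x k) x).det

variable {Φ : EuclideanSpace ℝ ι → EuclideanSpace ℝ ι}

lemma contDiff_coord (hΦ : ContDiff ℝ ∞ Φ) (k : ι) : ContDiff ℝ ∞ fun x => Φ x k :=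
  (EuclideanSpace.proj k : EuclideanSpace ℝ ι →L[ℝ] ℝ).contDiff.comp hΦ

lemma contDiff_jacDet (hΦ : ContDiff ℝ ∞ Φ) : ContDiff ℝ ∞ (jacDet Φ) :=
  contDiff_det (contDiff_jacobian (contDiff_coord hΦ))

lemma fderiv_coord (hΦ : ContDiff ℝ ∞ Φ) (k : ι) (x v : EuclideanSpace ℝ ι) :
    fderiv ℝ (fun x => Φ x k) x v = fderiv ℝ Φ x v k := by
  have h := ((EuclideanSpace.proj k : EuclideanSpace ℝ ι →L[ℝ] ℝ).hasFDerivAt.comp x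
    ((hΦ.differentiable (by simp)) x).hasFDerivAt).fderiv
  change fderiv ℝ ((EuclideanSpace.proj k : EuclideanSpace ℝ ι →L[ℝ] ℝ) ∘ Φ) x v = _
  rw [h]
  rfl

lemma jacobian_apply (hΦ : ContDiff ℝ ∞ Φ) (x : EuclideanSpace ℝ ι) (k j : ι) :
    jacobian (fun k x => Φ x k) x k j = fderiv ℝ Φ x (EuclideanSpace.single j 1) k :=
  fderiv_coord hΦ k x _

lemma det_fderiv_eq_jacDet (hΦ : ContDiff ℝ ∞ Φ) (x : EuclideanSpace ℝ ι) :
    (fderiv ℝ Φ x).det = jacDet Φ x := by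
  unfold jacDet
  rw [ContinuousLinearMap.det, ← LinearMap.det_toMatrix (EuclideanSpace.basisFun ι ℝ).toBasis]
  congr 1
  ext k j
  rw [jacobian_apply hΦ]
  simp [LinearMap.toMatrix_apply]

lemma eq_sum_single (v : EuclideanSpace ℝ ι) :
    v = ∑ k, v k • (EuclideanSpace.single k 1 : EuclideanSpace ℝ ι) := by
  ext l
  simp [Finset.sum_apply, Pi.single_apply]

lemma fderiv_apply_eq_sum (f : EuclideanSpace ℝ ι → ℝ) (x v : EuclideanSpace ℝ ι) :
    fderiv ℝ f x v = ∑ k, v k * partialD k f x := by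
  conv_lhs => rw [eq_sum_single v, map_sum]
  simp [partialD]

lemma partialD_comp (hΦ : ContDiff ℝ ∞ Φ) {g : EuclideanSpace ℝ ι → ℝ} (hg : ContDiff ℝ ∞ g)
    (j : ι) (x : EuclideanSpace ℝ ι) :
    partialD j (fun x => g (Φ x)) x =
      ∑ k, partialD k g (Φ x) * jacobian (fun k x => Φ x k) x k j := by
  have h := (((hg.differentiable (by simp)) (Φ x)).hasFDerivAt.comp x
    ((hΦ.differentiable (by simp)) x).hasFDerivAt).fderiv
  unfold partialD
  change fderiv ℝ (g ∘ Φ) x _ = _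
  rw [h, ContinuousLinearMap.comp_apply, fderiv_apply_eq_sum]
  refine Finset.sum_congr rfl fun k _ => ?_
  rw [jacobian_apply hΦ, mul_comm]
  rfl

lemma partialD_mul {u v : EuclideanSpace ℝ ι → ℝ} (hu : ContDiff ℝ ∞ u) (hv : ContDiff ℝ ∞ v)
    (j : ι) (x : EuclideanSpace ℝ ι) :
    partialD j (fun x => u x * v x) x = u x * partialD j v x + v x * partialD j u x := by
  unfold partialD
  rw [fderiv_fun_mul ((hu.differentiable (by simp)) x) ((hv.differentiable (by simp)) x)]
  simp

lemma integral_partialD_comp_mul_jacDet (hΦ : ContDiff ℝ ∞ Φ) {χ g : EuclideanSpace ℝ ι → ℝ}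
    (hχ : ContDiff ℝ ∞ χ) (hc : HasCompactSupport χ) (hg : ContDiff ℝ ∞ g)
    (hz : ∀ x j, g (Φ x) * partialD j χ x = 0) (i : ι) :
    ∫ x, χ x * partialD i g (Φ x) * jacDet Φ x = 0 := by
  have hgΦ : ContDiff ℝ ∞ fun x => g (Φ x) := hg.comp hΦ
  rw [← integral_det_updateRow_eq_zero (contDiff_coord hΦ) i (hχ.mul hgΦ) hc.mul_right]
  refine integral_congr_ae (Eventually.of_forall fun x => ?_)
  have : (fun j => partialD j (fun x => χ x * g (Φ x)) x) =
      ∑ k, (χ x * partialD k g (Φ x)) • jacobian (fun k x => Φ x k) x k := by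
    ext j
    rw [partialD_mul hχ hgΦ, hz, add_zero, partialD_comp hΦ hg, Finset.mul_sum]
    simp [Finset.sum_apply, mul_assoc]
  simp only [this]
  rw [Matrix.det_updateRow_sum]
  rfl

lemma integrable_coord_mul_det (hΦ : ContDiff ℝ ∞ Φ) {χ : EuclideanSpace ℝ ι → ℝ}
    (hχ : ContDiff ℝ ∞ χ) (hc : HasCompactSupport χ) (i : ι) :
    Integrable fun x => Φ x i *
      ((jacobian (fun k x => Φ x k) x).updateRow i (fun j => partialD j χ x)).det := by
  simp only [det_updateRow_eq_sum _ i (fun j => partialD j χ _), Finset.mul_sum]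
  refine integrable_finsetSum _ fun j _ => ?_
  have hcof := contDiff_det (contDiff_updateRow (contDiff_jacobian (contDiff_coord hΦ))
    (v := fun _ => Pi.single j 1) (fun l => contDiff_const) i)
  exact ((contDiff_coord hΦ i).continuous.mul ((contDiff_partialD hχ j).continuous.mul
    hcof.continuous)).integrable_of_hasCompactSupport
      (hasCompactSupport_partialD hc j).mul_right.mul_left

lemma integral_mul_jacDet_add (hΦ : ContDiff ℝ ∞ Φ) {χ : EuclideanSpace ℝ ι → ℝ}
    (hχ : ContDiff ℝ ∞ χ) (hc : HasCompactSupport χ) (i : ι) :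
    ∫ x, χ x * jacDet Φ x = - ∫ x, Φ x i *
      ((jacobian (fun k x => Φ x k) x).updateRow i (fun j => partialD j χ x)).det := by
  have h0 := integral_det_updateRow_eq_zero (contDiff_coord hΦ) i (hχ.mul (contDiff_coord hΦ i))
    hc.mul_right
  have h1 : ∀ x, ((jacobian (fun k x => Φ x k) x).updateRow i
      (fun j => partialD j (fun x => χ x * Φ x i) x)).det = χ x * jacDet Φ x + Φ x i *
      ((jacobian (fun k x => Φ x k) x).updateRow i (fun j => partialD j χ x)).det := by
    intro x
    have : (fun j => partialD j (fun x => χ x * Φ x i) x) =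
        χ x • jacobian (fun k x => Φ x k) x i + Φ x i • (fun j => partialD j χ x) := by
      ext j
      rw [partialD_mul hχ (contDiff_coord hΦ i)]
      rfl
    rw [this, Matrix.det_updateRow_add, Matrix.det_updateRow_smul, Matrix.det_updateRow_smul,
      Matrix.updateRow_eq_self]
    rfl
  simp only [h1] at h0
  rw [integral_add] at h0
  · linarith
  · exact (hχ.continuous.mul (contDiff_jacDet hΦ).continuous).integrable_of_hasCompactSupport
      hc.mul_right
  · exact integrable_coord_mul_det hΦ hχ hc i

/-- The push-forward of `χ dx` under `Φ` (counted with orientation), mollified by `g`. -/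
def degreeAvg (Φ : EuclideanSpace ℝ ι → EuclideanSpace ℝ ι) (χ g : EuclideanSpace ℝ ι → ℝ)
    (p : EuclideanSpace ℝ ι) : ℝ :=
  ∫ x, χ x * g (Φ x - p) * jacDet Φ x

lemma hasFDerivAt_degreeAvg (hΦ : ContDiff ℝ ∞ Φ) {χ g : EuclideanSpace ℝ ι → ℝ}
    (hχ : ContDiff ℝ ∞ χ) (hc : HasCompactSupport χ) (hg : ContDiff ℝ ∞ g)
    (hgc : HasCompactSupport g) (p : EuclideanSpace ℝ ι) :
    HasFDerivAt (degreeAvg Φ χ g)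
      (∫ x, -((χ x * jacDet Φ x) • fderiv ℝ g (Φ x - p))) p := by
  have hg' : Continuous (fderiv ℝ g) := hg.continuous_fderiv (by simp)
  obtain ⟨C, hC⟩ := (hgc.fderiv ℝ).exists_bound_of_continuous hg'
  have hw : Continuous fun x => χ x * jacDet Φ x := hχ.continuous.mul (contDiff_jacDet hΦ).continuous
  have hwc : HasCompactSupport fun x => χ x * jacDet Φ x := hc.mul_right
  have hj := (contDiff_jacDet hΦ).continuous
  have hΦc := hΦ.continuous
  have hχc := hχ.continuous
  have hgc' := hg.continuous
  unfold degreeAvg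
  refine hasFDerivAt_integral_of_dominated_of_fderiv_le (s := univ) (μ := volume)
    (F := fun p x => χ x * g (Φ x - p) * jacDet Φ x)
    (F' := fun p x => -((χ x * jacDet Φ x) • fderiv ℝ g (Φ x - p)))
    (bound := fun x => ‖χ x * jacDet Φ x‖ * C) univ_mem ?_ ?_ ?_ ?_ ?_ ?_
  · exact Eventually.of_forall fun p => (by fun_prop : Continuous _).aestronglyMeasurable
  · refine (by fun_prop : Continuous _).integrable_of_hasCompactSupport ?_
    exact hc.mul_right.mul_right
  · exact (by fun_prop : Continuous _).aestronglyMeasurable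
  · refine Eventually.of_forall fun x p _ => ?_
    rw [norm_neg, norm_smul]
    exact mul_le_mul_of_nonneg_left (hC _) (norm_nonneg _)
  · exact ((hw.integrable_of_hasCompactSupport hwc).norm).mul_const C
  · refine Eventually.of_forall fun x p _ => ?_
    have h1 : HasFDerivAt (fun p => g (Φ x - p)) (-(fderiv ℝ g (Φ x - p))) p := by
      have := ((hg.differentiable (by simp)) (Φ x - p)).hasFDerivAt.comp p
        ((hasFDerivAt_id p).const_sub (Φ x))
      convert! this using 1
      ext v
      simp
    have h2 := (h1.const_mul (χ x)).mul_const (jacDet Φ x)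
    convert! h2 using 1
    ext v
    simp
    ring

/-- The mollified degree is locally constant away from the image of the support of `∇χ`. -/
lemma fderiv_degreeAvg_eq_zero (hΦ : ContDiff ℝ ∞ Φ) {χ g : EuclideanSpace ℝ ι → ℝ}
    (hχ : ContDiff ℝ ∞ χ) (hc : HasCompactSupport χ) (hg : ContDiff ℝ ∞ g)
    (hgc : HasCompactSupport g) {p : EuclideanSpace ℝ ι}
    (hz : ∀ x j, g (Φ x - p) * partialD j χ x = 0) :
    fderiv ℝ (degreeAvg Φ χ g) p = 0 := by
  have hg' : Continuous (fderiv ℝ g) := hg.continuous_fderiv (by simp)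
  have hj := (contDiff_jacDet hΦ).continuous
  have hΦc := hΦ.continuous
  have hχc := hχ.continuous
  rw [(hasFDerivAt_degreeAvg hΦ hχ hc hg hgc p).fderiv]
  have hint : Integrable fun x => -((χ x * jacDet Φ x) • fderiv ℝ g (Φ x - p)) := by
    refine (by fun_prop : Continuous _).integrable_of_hasCompactSupport ?_
    exact (HasCompactSupport.smul_right (hc.mul_right)).neg
  have hgp : ContDiff ℝ ∞ fun y => g (y - p) := hg.comp (contDiff_id.sub contDiff_const)
  ext v
  rw [ContinuousLinearMap.integral_apply hint]
  have key : ∀ i, ∫ x, χ x * partialD i g (Φ x - p) * jacDet Φ x = 0 := by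
    intro i
    rw [← integral_partialD_comp_mul_jacDet hΦ hχ hc hgp hz i]
    refine integral_congr_ae (Eventually.of_forall fun x => ?_)
    simp [partialD, fderiv_comp_sub]
  have h3 : ∀ x, (-((χ x * jacDet Φ x) • fderiv ℝ g (Φ x - p))) v =
      ∑ i, -(v i) * (χ x * partialD i g (Φ x - p) * jacDet Φ x) := by
    intro x
    simp only [neg_apply, smul_apply, smul_eq_mul]
    rw [fderiv_apply_eq_sum, Finset.mul_sum, ← Finset.sum_neg_distrib]
    exact Finset.sum_congr rfl fun i _ => by ring
  simp only [h3]
  rw [integral_finsetSum]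
  · refine Finset.sum_eq_zero fun i _ => ?_
    rw [integral_const_mul, key, mul_zero]
  · intro i _
    have := (contDiff_partialD hg i).continuous
    refine ((by fun_prop : Continuous _).integrable_of_hasCompactSupport ?_).const_mul _
    exact hc.mul_right.mul_right

end Pushforward

section Rotation

variable {ι : Type*} [Fintype ι] [DecidableEq ι]

lemma contDiff_eval (a : ι) : ContDiff ℝ ∞ fun x : EuclideanSpace ℝ ι => x a :=
  (EuclideanSpace.proj a : EuclideanSpace ℝ ι →L[ℝ] ℝ).contDiff

lemma partialD_eval (j a : ι) (x : EuclideanSpace ℝ ι) :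
    partialD j (fun x : EuclideanSpace ℝ ι => x a) x = if a = j then 1 else 0 := by
  unfold partialD
  change fderiv ℝ (EuclideanSpace.proj a : EuclideanSpace ℝ ι →L[ℝ] ℝ) x _ = _
  rw [ContinuousLinearMap.fderiv]
  simp

lemma partialD_sub {u v : EuclideanSpace ℝ ι → ℝ} (hu : ContDiff ℝ ∞ u) (hv : ContDiff ℝ ∞ v)
    (j : ι) (x : EuclideanSpace ℝ ι) :
    partialD j (fun x => u x - v x) x = partialD j u x - partialD j v x := by
  unfold partialD
  rw [fderiv_fun_sub ((hu.differentiable (by simp)) x) ((hv.differentiable (by simp)) x)]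
  rfl

lemma partialD_radial {h : ℝ → ℝ} (hh : ContDiff ℝ ∞ h) (j : ι) (x : EuclideanSpace ℝ ι) :
    partialD j (fun x => h (‖x‖ ^ 2)) x = 2 * deriv h (‖x‖ ^ 2) * x j := by
  have h1 := ((hh.differentiable (by simp)) (‖x‖ ^ 2)).hasDerivAt.comp_hasFDerivAt x
    (hasStrictFDerivAt_norm_sq x).hasFDerivAt
  unfold partialD
  change fderiv ℝ (h ∘ fun x => ‖x‖ ^ 2) x _ = _
  rw [h1.fderiv]
  simp [EuclideanSpace.inner_single_right]
  ring

lemma contDiff_radial {h : ℝ → ℝ} (hh : ContDiff ℝ ∞ h) :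
    ContDiff ℝ ∞ fun x : EuclideanSpace ℝ ι => h (‖x‖ ^ 2) :=
  hh.comp (contDiff_norm_sq ℝ)

/-- The derivative of `w` along the infinitesimal rotation in the `(a, b)`-plane. -/
def rotD (a b : ι) (w : EuclideanSpace ℝ ι → ℝ) (x : EuclideanSpace ℝ ι) : ℝ :=
  x a * partialD b w x - x b * partialD a w x

lemma integrable_mul_partialD {w : EuclideanSpace ℝ ι → ℝ} (hw : ContDiff ℝ ∞ w)
    (hc : HasCompactSupport w) (a b : ι) : Integrable fun x => x a * partialD b w x :=
  ((contDiff_eval a).continuous.mul (contDiff_partialD hw b).continuous).integrable_of_hasCompactSupport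
    (hasCompactSupport_partialD hc b).mul_left

lemma integrable_rotD {w : EuclideanSpace ℝ ι → ℝ} (hw : ContDiff ℝ ∞ w)
    (hc : HasCompactSupport w) (a b : ι) : Integrable (rotD a b w) :=
  (integrable_mul_partialD hw hc a b).sub (integrable_mul_partialD hw hc b a)

lemma integral_rotD {w : EuclideanSpace ℝ ι → ℝ} (hw : ContDiff ℝ ∞ w)
    (hc : HasCompactSupport w) {a b : ι} (hab : a ≠ b) : ∫ x, rotD a b w x = 0 := by
  have h : ∀ a b : ι, a ≠ b → ∫ x, x a * partialD b w x = 0 := by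
    intro a b hab
    have := integral_partialD_mul hw (contDiff_eval a) hc b
    simp only [partialD_eval, hab, if_false, mul_zero, integral_zero, neg_zero] at this
    simpa only [mul_comm] using this
  unfold rotD
  rw [integral_sub (integrable_mul_partialD hw hc a b) (integrable_mul_partialD hw hc b a),
    h a b hab, h b a hab.symm, sub_zero]

/-- A closed one-form integrates to zero against an infinitesimal rotation with radial weight,
since rotations are commutators of rotations. -/
lemma integral_radial_mul_rotation {α : ι → EuclideanSpace ℝ ι → ℝ}
    (hα : ∀ j, ContDiff ℝ ∞ (α j)) {h : ℝ → ℝ} (hh : ContDiff ℝ ∞ h)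
    (hc : HasCompactSupport fun x : EuclideanSpace ℝ ι => h (‖x‖ ^ 2))
    (hclosed : ∀ x : EuclideanSpace ℝ ι, h (‖x‖ ^ 2) ≠ 0 →
      ∀ i j, partialD i (α j) x = partialD j (α i) x)
    {a b c : ι} (hab : a ≠ b) (hac : a ≠ c) (hbc : b ≠ c) :
    ∫ x, h (‖x‖ ^ 2) * (x a * α b x - x b * α a x) = 0 := by
  have hη := contDiff_radial (ι := ι) hh
  have hs : ∀ i j k l : ι, ContDiff ℝ ∞ fun x : EuclideanSpace ℝ ι => x i * α j x - x k * α l x :=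
    fun i j k l => ((contDiff_eval i).mul (hα j)).sub ((contDiff_eval k).mul (hα l))
  have h1 := integral_rotD (hη.mul (hs c b b c)) hc.mul_right hac
  have h2 := integral_rotD (hη.mul (hs a c c a)) hc.mul_right hbc.symm
  have i1 := integrable_rotD (hη.mul (hs c b b c)) hc.mul_right a c
  have i2 := integrable_rotD (hη.mul (hs a c c a)) hc.mul_right c b
  have h3 := integral_sub i1 i2
  rw [h1, h2, sub_zero] at h3
  rw [← h3]
  refine integral_congr_ae (Eventually.of_forall fun x => ?_)
  simp only [rotD]
  have hd : ∀ i j k l m, partialD m (fun x : EuclideanSpace ℝ ι => x i * α j x - x k * α l x) x =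
      (x i * partialD m (α j) x + α j x * (if i = m then 1 else 0)) -
      (x k * partialD m (α l) x + α l x * (if k = m then 1 else 0)) := by
    intro i j k l m
    rw [partialD_sub ((contDiff_eval i).mul (hα j)) ((contDiff_eval k).mul (hα l)),
      partialD_mul (contDiff_eval i) (hα j), partialD_mul (contDiff_eval k) (hα l), partialD_eval,
      partialD_eval]
  simp only [partialD_mul hη (hs _ _ _ _), partialD_radial hh, hd, hab, hac, hbc, hab.symm,
    hac.symm, hbc.symm, if_true, if_false]
  by_cases h0 : h (‖x‖ ^ 2) = 0
  · simp only [h0]; ring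
  · rw [hclosed x h0 c b, hclosed x h0 b a, hclosed x h0 a c]
    ring

end Rotation

section Symplectic

variable {n : ℕ}

/-- The index of the coordinate `x_i`. -/
def idxX (i : Fin n) : Fin (2 * n) := ⟨2 * i.1, by have := i.isLt; omega⟩

/-- The index of the coordinate `y_i`. -/
def idxY (i : Fin n) : Fin (2 * n) := ⟨2 * i.1 + 1, by have := i.isLt; omega⟩

/-- The splitting of the coordinates of `ℝ^{2n}` into position and momentum coordinates. -/
def idxEquiv (n : ℕ) : Fin n ⊕ Fin n ≃ Fin (2 * n) :=
  Equiv.ofBijective (Sum.elim idxX idxY) <| by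
    rw [Fintype.bijective_iff_injective_and_card]
    refine ⟨?_, by simp; omega⟩
    rintro (i | i) (j | j) h <;> simp [idxX, idxY, Fin.ext_iff] at h ⊢ <;> omega

@[simp] lemma idxEquiv_inl (i : Fin n) : idxEquiv n (Sum.inl i) = idxX i := rfl

@[simp] lemma idxEquiv_inr (i : Fin n) : idxEquiv n (Sum.inr i) = idxY i := rfl

lemma sum_idx (g : Fin (2 * n) → ℝ) : ∑ j, g j = ∑ i : Fin n, (g (idxX i) + g (idxY i)) := by
  rw [← (idxEquiv n).sum_comp, Fintype.sum_sum_type, Finset.sum_add_distrib]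
  rfl

lemma sympForm_eq (v w : R2n n) :
    sympForm n v w = ∑ i : Fin n, (v (idxX i) * w (idxY i) - v (idxY i) * w (idxX i)) := rfl

/-- The symplectic form as a bilinear map. -/
def sympBilin (n : ℕ) : R2n n →ₗ[ℝ] R2n n →ₗ[ℝ] ℝ :=
  LinearMap.mk₂ ℝ (sympForm n)
    (fun u v w => by
      simp only [sympForm_eq, ← Finset.sum_add_distrib]
      exact Finset.sum_congr rfl fun i _ => by simp; ring)
    (fun c u v => by
      simp only [sympForm_eq, smul_eq_mul, Finset.mul_sum]
      exact Finset.sum_congr rfl fun i _ => by simp; ring)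
    (fun u v w => by
      simp only [sympForm_eq, ← Finset.sum_add_distrib]
      exact Finset.sum_congr rfl fun i _ => by simp; ring)
    (fun c u v => by
      simp only [sympForm_eq, smul_eq_mul, Finset.mul_sum]
      exact Finset.sum_congr rfl fun i _ => by simp; ring)

lemma sympBilin_apply (v w : R2n n) : sympBilin n v w = sympForm n v w := rfl

lemma sympForm_neg_swap (v w : R2n n) : sympForm n v w = - sympForm n w v := by
  simp only [sympForm_eq, ← Finset.sum_neg_distrib]
  exact Finset.sum_congr rfl fun i _ => by ring

lemma dotProduct_J_mulVec (v w : R2n n) :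
    (fun s => v (idxEquiv n s)) ⬝ᵥ (Matrix.J (Fin n) ℝ).mulVec (fun s => w (idxEquiv n s)) =
      - sympForm n v w := by
  simp only [Matrix.J, dotProduct, Matrix.mulVec, Fintype.sum_sum_type, Matrix.fromBlocks_apply₁₁,
    Matrix.fromBlocks_apply₁₂, Matrix.fromBlocks_apply₂₁, Matrix.fromBlocks_apply₂₂,
    sympForm_eq, Matrix.neg_apply, Matrix.one_apply, Matrix.zero_apply]
  simp [Finset.sum_sub_distrib]
  ring

lemma det_eq_one_of_sympForm (L : R2n n →L[ℝ] R2n n)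
    (hL : ∀ v w, sympForm n (L v) (L w) = sympForm n v w) : L.det = 1 := by
  set b := (EuclideanSpace.basisFun (Fin (2 * n)) ℝ).toBasis.reindex (idxEquiv n).symm with hb
  rw [ContinuousLinearMap.det, ← LinearMap.det_toMatrix b]
  refine SymplecticGroup.det_eq_one ?_
  rw [SymplecticGroup.mem_iff']
  have hM : ∀ s t, LinearMap.toMatrix b b (L : R2n n →ₗ[ℝ] R2n n) s t =
      L (b t) (idxEquiv n s) := by
    intro s t
    rw [LinearMap.toMatrix_apply]
    simp [hb]
  have hbs : ∀ s t, b t (idxEquiv n s) = (1 : Matrix _ _ ℝ) s t := by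
    intro s t
    simp [hb, Matrix.one_apply]
  have key : ∀ (A : Matrix (Fin n ⊕ Fin n) (Fin n ⊕ Fin n) ℝ) s t,
      (A.transpose * Matrix.J (Fin n) ℝ * A) s t =
        (fun u => A u s) ⬝ᵥ (Matrix.J (Fin n) ℝ).mulVec (fun u => A u t) := by
    intro A s t
    rw [Matrix.mul_assoc]
    rfl
  have h1 := key 1
  ext s t
  rw [key]
  simp only [hM]
  rw [dotProduct_J_mulVec, hL, ← dotProduct_J_mulVec]
  simp only [hbs]
  rw [← key]
  simp

lemma sympForm_single_left_X (i : Fin n) (w : R2n n) :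
    sympForm n (EuclideanSpace.single (idxX i) 1) w = w (idxY i) := by
  have : ∀ j : Fin n, idxY j ≠ idxX i := fun j h => by
    simp [idxX, idxY, Fin.ext_iff] at h; omega
  have h2 : ∀ j : Fin n, idxX j = idxX i ↔ j = i := fun j => by
    simp [idxX, Fin.ext_iff]
  simp [sympForm_eq, this, h2]

lemma sympForm_single_left_Y (i : Fin n) (w : R2n n) :
    sympForm n (EuclideanSpace.single (idxY i) 1) w = - w (idxX i) := by
  have : ∀ j : Fin n, idxX j ≠ idxY i := fun j h => by
    simp [idxX, idxY, Fin.ext_iff] at h; omega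
  have h2 : ∀ j : Fin n, idxY j = idxY i ↔ j = i := fun j => by
    simp [idxY, Fin.ext_iff]
  simp [sympForm_eq, this, h2]

/-- The complex structure, written in coordinates. -/
def rotK (x : R2n n) : R2n n :=
  ∑ i : Fin n, (x (idxY i) • EuclideanSpace.single (idxX i) 1 -
    x (idxX i) • EuclideanSpace.single (idxY i) 1)

lemma sympForm_rotK (x w : R2n n) : sympForm n (rotK x) w = ∑ j, x j * w j := by
  rw [sum_idx, ← sympBilin_apply, rotK, map_sum, LinearMap.sum_apply]
  refine Finset.sum_congr rfl fun i _ => ?_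
  simp only [map_sub, map_smul, LinearMap.sub_apply, LinearMap.smul_apply, sympBilin_apply,
    sympForm_single_left_X, sympForm_single_left_Y, smul_eq_mul]
  ring

end Symplectic

section Volume

variable {n : ℕ}

/-- The symplectic form as a continuous bilinear map. -/
def sympCLM (n : ℕ) : R2n n →L[ℝ] R2n n →L[ℝ] ℝ :=
  LinearMap.toContinuousBilinearMap (sympBilin n)

lemma sympCLM_apply (v w : R2n n) : sympCLM n v w = sympForm n v w := rfl

/-- The `j`-th component of the difference of the pullback under `Φ` of the radial primitive of
(twice) the symplectic form and that primitive. -/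
def liouvilleDiff (Φ : R2n n → R2n n) (j : Fin (2 * n)) (x : R2n n) : ℝ :=
  sympCLM n (Φ x) (fderiv ℝ Φ x (EuclideanSpace.single j 1)) -
    sympCLM n x (EuclideanSpace.single j 1)

variable {Φ : R2n n → R2n n}

lemma contDiff_fderiv_single (hΦ : ContDiff ℝ ∞ Φ) (j : Fin (2 * n)) :
    ContDiff ℝ ∞ fun x => fderiv ℝ Φ x (EuclideanSpace.single j 1) :=
  (hΦ.fderiv_right (m := ∞) (by simp)).clm_apply contDiff_const

lemma contDiff_liouvilleDiff (hΦ : ContDiff ℝ ∞ Φ) (j : Fin (2 * n)) :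
    ContDiff ℝ ∞ (liouvilleDiff Φ j) :=
  (((sympCLM n).contDiff.comp hΦ).clm_apply (contDiff_fderiv_single hΦ j)).sub
    ((sympCLM n).contDiff.clm_apply contDiff_const)

lemma partialD_liouvilleDiff (hΦ : ContDiff ℝ ∞ Φ) (l j : Fin (2 * n)) (x : R2n n) :
    partialD l (liouvilleDiff Φ j) x =
      sympForm n (Φ x) (fderiv ℝ (fderiv ℝ Φ) x (EuclideanSpace.single l 1)
        (EuclideanSpace.single j 1)) +
      sympForm n (fderiv ℝ Φ x (EuclideanSpace.single l 1))
        (fderiv ℝ Φ x (EuclideanSpace.single j 1)) -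
      sympForm n (EuclideanSpace.single l 1) (EuclideanSpace.single j 1) := by
  have h1 : HasFDerivAt Φ (fderiv ℝ Φ x) x := ((hΦ.differentiable (by simp)) x).hasFDerivAt
  have h2 : HasFDerivAt (fderiv ℝ Φ) (fderiv ℝ (fderiv ℝ Φ) x) x :=
    (((hΦ.fderiv_right (m := ∞) (by simp)).differentiable (by simp)) x).hasFDerivAt
  have h3 := h2.clm_apply (hasFDerivAt_const (EuclideanSpace.single j (1 : ℝ)) x)
  have h4 := ((sympCLM n).hasFDerivAt_of_bilinear h1 h3).sub
    (((sympCLM n).flip (EuclideanSpace.single j (1 : ℝ))).hasFDerivAt (x := x))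
  unfold partialD
  have h5 : liouvilleDiff Φ j = (fun y => sympCLM n (Φ y) (fderiv ℝ Φ y (EuclideanSpace.single j 1)))
      - ⇑((sympCLM n).flip (EuclideanSpace.single j (1 : ℝ))) := rfl
  rw [h5, h4.fderiv]
  simp [← sympCLM_apply]

lemma liouvilleDiff_closed (hΦ : ContDiff ℝ ∞ Φ) {x : R2n n}
    (hs : ∀ v w, sympForm n (fderiv ℝ Φ x v) (fderiv ℝ Φ x w) = sympForm n v w)
    (i j : Fin (2 * n)) :
    partialD i (liouvilleDiff Φ j) x = partialD j (liouvilleDiff Φ i) x := by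
  rw [partialD_liouvilleDiff hΦ, partialD_liouvilleDiff hΦ, hs, hs]
  have hsymm := (hΦ.contDiffAt (x := x)).isSymmSndFDerivAt
    (by simp only [minSmoothness_of_isRCLikeNormedField]; exact WithTop.coe_le_coe.2 le_top)
  rw [hsymm (EuclideanSpace.single i 1) (EuclideanSpace.single j 1)]
  ring

/-- The normal component of the cofactor flux of a symplectic map. -/
lemma sum_coord_mul_det_of_symplectic (hΦ : ContDiff ℝ ∞ Φ) {h : ℝ → ℝ} (hh : ContDiff ℝ ∞ h)
    (x : R2n n) (hs : deriv h (‖x‖ ^ 2) ≠ 0 →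
      ∀ v w, sympForm n (fderiv ℝ Φ x v) (fderiv ℝ Φ x w) = sympForm n v w) :
    ∑ i, Φ x i * ((jacobian (fun k x => Φ x k) x).updateRow i
      (fun j => partialD j (fun x => h (‖x‖ ^ 2)) x)).det =
      2 * deriv h (‖x‖ ^ 2) * sympForm n (fderiv ℝ Φ x (rotK x)) (Φ x) := by
  set M := jacobian (fun k x => Φ x k) x with hM
  have h1 : ∀ i, (M.updateRow i (fun j => partialD j (fun x => h (‖x‖ ^ 2)) x)).det =
      2 * deriv h (‖x‖ ^ 2) * ∑ j, x j * M.adjugate j i := by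
    intro i
    rw [det_updateRow_eq_sum, Finset.mul_sum]
    refine Finset.sum_congr rfl fun j _ => ?_
    rw [partialD_radial hh, Matrix.adjugate_apply]
    ring
  simp only [h1]
  by_cases h0 : deriv h (‖x‖ ^ 2) = 0
  · simp [h0]
  have hs := hs h0
  have hdet : M.det = 1 := by
    have := det_eq_one_of_sympForm _ hs
    rwa [det_fderiv_eq_jacDet hΦ] at this
  set w : R2n n := WithLp.toLp 2 (M.adjugate.mulVec (Φ x)) with hw
  have hLw : fderiv ℝ Φ x w = Φ x := by
    ext k
    have e1 : fderiv ℝ Φ x w k = M.mulVec (M.adjugate.mulVec (Φ x)) k := by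
      conv_lhs => rw [eq_sum_single w, map_sum]
      simp only [map_smul, WithLp.ofLp_sum, WithLp.ofLp_smul, Finset.sum_apply, Pi.smul_apply,
        smul_eq_mul]
      refine Finset.sum_congr rfl fun j _ => ?_
      change w j * _ = jacobian (fun k x => Φ x k) x k j * w j
      rw [jacobian_apply hΦ]
      exact mul_comm (w j) _
    rw [e1, Matrix.mulVec_mulVec, Matrix.mul_adjugate, hdet]
    simp
  have h2 : ∑ j, x j * w j = sympForm n (fderiv ℝ Φ x (rotK x)) (Φ x) := by
    rw [← sympForm_rotK, ← hs, hLw]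
  rw [← h2]
  have h3 : ∀ j, w j = ∑ i, M.adjugate j i * Φ x i := fun j => rfl
  simp only [h3, Finset.mul_sum]
  rw [Finset.sum_comm]
  refine Finset.sum_congr rfl fun i _ => Finset.sum_congr rfl fun j _ => ?_
  ring

lemma mul_integral_mul_jacDet (hΦ : ContDiff ℝ ∞ Φ) {h : ℝ → ℝ} (hh : ContDiff ℝ ∞ h)
    (hc : HasCompactSupport fun x : R2n n => h (‖x‖ ^ 2))
    (hs : ∀ x : R2n n, deriv h (‖x‖ ^ 2) ≠ 0 →
      ∀ v w, sympForm n (fderiv ℝ Φ x v) (fderiv ℝ Φ x w) = sympForm n v w) :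
    (Integrable fun x => 2 * deriv h (‖x‖ ^ 2) * sympForm n (fderiv ℝ Φ x (rotK x)) (Φ x)) ∧
    (2 * n : ℕ) * ∫ x : R2n n, h (‖x‖ ^ 2) * jacDet Φ x =
      - ∫ x, 2 * deriv h (‖x‖ ^ 2) * sympForm n (fderiv ℝ Φ x (rotK x)) (Φ x) := by
  have hχ := contDiff_radial (ι := Fin (2 * n)) hh
  simp only [← sum_coord_mul_det_of_symplectic hΦ hh _ (hs _)]
  refine ⟨integrable_finsetSum _ fun i _ => integrable_coord_mul_det hΦ hχ hc i, ?_⟩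
  rw [integral_finsetSum _ fun i _ => integrable_coord_mul_det hΦ hχ hc i,
    ← Finset.sum_neg_distrib]
  simp only [← integral_mul_jacDet_add hΦ hχ hc]
  simp

/-- A map which is symplectic where a radial cutoff varies preserves the cutoff volume. -/
theorem integral_radial_mul_jacDet (hn : 2 ≤ n) (hΦ : ContDiff ℝ ∞ Φ) {h : ℝ → ℝ}
    (hh : ContDiff ℝ ∞ h) (hc : HasCompactSupport fun x : R2n n => h (‖x‖ ^ 2))
    (hc' : HasCompactSupport fun x : R2n n => deriv h (‖x‖ ^ 2))
    (hs : ∀ x : R2n n, deriv h (‖x‖ ^ 2) ≠ 0 →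
      ∀ v w, sympForm n (fderiv ℝ Φ x v) (fderiv ℝ Φ x w) = sympForm n v w) :
    ∫ x : R2n n, h (‖x‖ ^ 2) * jacDet Φ x = ∫ x : R2n n, h (‖x‖ ^ 2) := by
  obtain ⟨i1, e1⟩ := mul_integral_mul_jacDet hΦ hh hc hs
  obtain ⟨i2, e2⟩ := mul_integral_mul_jacDet (Φ := fun x : R2n n => x) contDiff_id hh hc
    (fun x _ v w => by simp)
  have hid : ∀ x : R2n n, jacDet (fun x : R2n n => x) x = 1 := by
    intro x
    rw [← det_fderiv_eq_jacDet (Φ := fun x : R2n n => x) contDiff_id]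
    simp [ContinuousLinearMap.det]
  simp only [hid, mul_one] at e2
  have hh' : ContDiff ℝ ∞ (deriv h) := hh.deriv'
  have hzero : ∫ x, (2 * deriv h (‖x‖ ^ 2) * sympForm n (fderiv ℝ Φ x (rotK x)) (Φ x) -
      2 * deriv h (‖x‖ ^ 2) * sympForm n (fderiv ℝ (fun x : R2n n => x) x (rotK x)) x) = 0 := by
    have hpt : ∀ x, 2 * deriv h (‖x‖ ^ 2) * sympForm n (fderiv ℝ Φ x (rotK x)) (Φ x) -
      2 * deriv h (‖x‖ ^ 2) * sympForm n (fderiv ℝ (fun x : R2n n => x) x (rotK x)) x =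
      ∑ i : Fin n, (-2) * (deriv h (‖x‖ ^ 2) * (x (idxY i) * liouvilleDiff Φ (idxX i) x -
        x (idxX i) * liouvilleDiff Φ (idxY i) x)) := by
      intro x
      rw [sympForm_neg_swap _ (Φ x), sympForm_neg_swap _ x]
      simp only [← sympCLM_apply, fderiv_fun_id, ContinuousLinearMap.id_apply, rotK, map_sum, map_sub,
        map_smul, smul_eq_mul, liouvilleDiff]
      rw [← mul_sub, neg_sub_neg, ← Finset.sum_sub_distrib, Finset.mul_sum]
      refine Finset.sum_congr rfl fun i _ => ?_
      ring
    simp only [hpt]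
    have hint : ∀ a b : Fin (2 * n), Integrable fun x : R2n n => deriv h (‖x‖ ^ 2) *
        (x a * liouvilleDiff Φ b x - x b * liouvilleDiff Φ a x) := by
      intro a b
      refine Continuous.integrable_of_hasCompactSupport ?_ hc'.mul_right
      exact (contDiff_radial hh').continuous.mul
        (((contDiff_eval a).continuous.mul (contDiff_liouvilleDiff hΦ b).continuous).sub
          ((contDiff_eval b).continuous.mul (contDiff_liouvilleDiff hΦ a).continuous))
    rw [integral_finsetSum _ fun i _ => (hint _ _).const_mul _]
    refine Finset.sum_eq_zero fun i _ => ?_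
    obtain ⟨k, hk⟩ : ∃ k : Fin n, k ≠ i := by
      have : Nontrivial (Fin n) := Fin.nontrivial_iff_two_le.2 hn
      exact exists_ne i
    have hk' : k.1 ≠ i.1 := fun h => hk (Fin.ext h)
    rw [integral_const_mul, integral_radial_mul_rotation (contDiff_liouvilleDiff hΦ) hh' hc'
      (fun x hx i j => liouvilleDiff_closed hΦ (hs x hx) i j) (c := idxX k), mul_zero]
    · simp [idxX, idxY]
    · simp [idxX, idxY]; omega
    · simp [idxX]; omega
  rw [integral_sub i1 i2, sub_eq_zero] at hzero
  rw [hzero, ← e2] at e1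
  have hpos : ((2 * n : ℕ) : ℝ) ≠ 0 := by
    have : 2 * n ≠ 0 := by omega
    exact_mod_cast this
  exact mul_left_cancel₀ hpos e1

end Volume

section Cutoff

/-- A smooth function equal to `1` on `(-∞, α²]` and to `0` on `[β², ∞)`. -/
def radCut (α β s : ℝ) : ℝ := Real.smoothTransition ((β ^ 2 - s) / (β ^ 2 - α ^ 2))

lemma contDiff_radCut (α β : ℝ) : ContDiff ℝ ∞ (radCut α β) :=
  Real.smoothTransition.contDiff.comp ((contDiff_const.sub contDiff_id).div_const _)

lemma radCut_nonneg (α β s : ℝ) : 0 ≤ radCut α β s := Real.smoothTransition.nonneg _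

lemma radCut_le_one (α β s : ℝ) : radCut α β s ≤ 1 := Real.smoothTransition.le_one _

variable {α β : ℝ}

lemma radCut_eq_one (h0 : 0 < α) (hαβ : α < β) {s : ℝ} (hs : s ≤ α ^ 2) : radCut α β s = 1 := by
  apply Real.smoothTransition.one_of_one_le
  rw [one_le_div (by nlinarith)]
  linarith

lemma radCut_eq_zero (h0 : 0 < α) (hαβ : α < β) {s : ℝ} (hs : β ^ 2 ≤ s) : radCut α β s = 0 := by
  apply Real.smoothTransition.zero_of_nonpos
  exact div_nonpos_of_nonpos_of_nonneg (by linarith) (by nlinarith)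

lemma deriv_radCut_eq_zero (h0 : 0 < α) (hαβ : α < β) {s : ℝ} (hs : s < α ^ 2 ∨ β ^ 2 < s) :
    deriv (radCut α β) s = 0 := by
  rcases hs with hs | hs
  · have : radCut α β =ᶠ[𝓝 s] fun _ => 1 := by
      filter_upwards [Iio_mem_nhds hs] with u hu using radCut_eq_one h0 hαβ (le_of_lt hu)
    rw [this.deriv_eq, deriv_const]
  · have : radCut α β =ᶠ[𝓝 s] fun _ => 0 := by
      filter_upwards [Ioi_mem_nhds hs] with u hu using radCut_eq_zero h0 hαβ (le_of_lt hu)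
    rw [this.deriv_eq, deriv_const]

variable {ι : Type*} [Fintype ι]

/-- A smooth radial cutoff equal to `1` for `‖x‖ ≤ α` and to `0` for `‖x‖ ≥ β`. -/
def cut (α β : ℝ) (x : EuclideanSpace ℝ ι) : ℝ := radCut α β (‖x‖ ^ 2)

lemma contDiff_cut (α β : ℝ) : ContDiff ℝ ∞ (cut α β : EuclideanSpace ℝ ι → ℝ) :=
  (contDiff_radCut α β).comp (contDiff_norm_sq ℝ)

lemma cut_nonneg (x : EuclideanSpace ℝ ι) : 0 ≤ cut α β x := radCut_nonneg _ _ _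

lemma cut_le_one (x : EuclideanSpace ℝ ι) : cut α β x ≤ 1 := radCut_le_one _ _ _

lemma cut_eq_one (h0 : 0 < α) (hαβ : α < β) {x : EuclideanSpace ℝ ι} (hx : ‖x‖ ≤ α) :
    cut α β x = 1 :=
  radCut_eq_one h0 hαβ (by gcongr)

lemma cut_eq_zero (h0 : 0 < α) (hαβ : α < β) {x : EuclideanSpace ℝ ι} (hx : β ≤ ‖x‖) :
    cut α β x = 0 :=
  radCut_eq_zero h0 hαβ (pow_le_pow_left₀ (h0.trans hαβ).le hx 2)

lemma mem_of_deriv_radCut_ne_zero (h0 : 0 < α) (hαβ : α < β) {x : EuclideanSpace ℝ ι}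
    (hx : deriv (radCut α β) (‖x‖ ^ 2) ≠ 0) : α ≤ ‖x‖ ∧ ‖x‖ ≤ β := by
  by_contra hcon
  refine hx (deriv_radCut_eq_zero h0 hαβ ?_)
  by_contra! h
  exact hcon ⟨le_of_sq_le_sq h.1 (norm_nonneg _), le_of_sq_le_sq h.2 (h0.trans hαβ).le⟩

lemma hasCompactSupport_of_norm_gt {f : EuclideanSpace ℝ ι → ℝ} (β : ℝ)
    (h : ∀ x, β < ‖x‖ → f x = 0) : HasCompactSupport f :=
  HasCompactSupport.intro (isCompact_closedBall 0 β) fun x hx => h x (by simpa using hx)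

lemma hasCompactSupport_cut (h0 : 0 < α) (hαβ : α < β) :
    HasCompactSupport (cut α β : EuclideanSpace ℝ ι → ℝ) :=
  hasCompactSupport_of_norm_gt β fun _ hx => cut_eq_zero h0 hαβ hx.le

lemma hasCompactSupport_deriv_radCut (h0 : 0 < α) (hαβ : α < β) :
    HasCompactSupport fun x : EuclideanSpace ℝ ι => deriv (radCut α β) (‖x‖ ^ 2) :=
  hasCompactSupport_of_norm_gt β fun x hx => by
    by_contra h
    exact absurd (mem_of_deriv_radCut_ne_zero h0 hαβ h).2 hx.not_ge

lemma integrable_cut (h0 : 0 < α) (hαβ : α < β) :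
    Integrable (cut α β : EuclideanSpace ℝ ι → ℝ) :=
  (contDiff_cut α β).continuous.integrable_of_hasCompactSupport (hasCompactSupport_cut h0 hαβ)

lemma partialD_cut_eq_zero [DecidableEq ι] (h0 : 0 < α) (hαβ : α < β) {x : EuclideanSpace ℝ ι}
    (hx : ¬ (α ≤ ‖x‖ ∧ ‖x‖ ≤ β)) (j : ι) : partialD j (cut α β) x = 0 := by
  have h := partialD_radial (contDiff_radCut α β) j x
  have h2 : deriv (radCut α β) (‖x‖ ^ 2) = 0 := by
    by_contra h3
    exact hx (mem_of_deriv_radCut_ne_zero h0 hαβ h3)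
  rw [h2, mul_zero, zero_mul] at h
  exact h

lemma volume_real_closedBall_eq_pow {r : ℝ} (hr : 0 ≤ r) :
    volume.real (closedBall (0 : EuclideanSpace ℝ ι) r) =
      r ^ Fintype.card ι * volume.real (closedBall (0 : EuclideanSpace ℝ ι) 1) := by
  rw [measureReal_def, Measure.addHaar_closedBall' _ _ hr, ENNReal.toReal_mul,
    ENNReal.toReal_ofReal (by positivity), finrank_euclideanSpace, measureReal_def]

lemma volume_real_closedBall_one_pos :
    0 < volume.real (closedBall (0 : EuclideanSpace ℝ ι) 1) :=
  ENNReal.toReal_pos (measure_closedBall_pos _ _ one_pos).ne' measure_closedBall_lt_top.ne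

lemma integrable_indicator_const {T : Set (EuclideanSpace ℝ ι)} (hT : MeasurableSet T)
    (hT1 : T ⊆ closedBall 0 1) : Integrable (T.indicator (1 : EuclideanSpace ℝ ι → ℝ)) :=
  (integrable_indicator_iff hT).2
    (integrableOn_const ((measure_mono hT1).trans_lt measure_closedBall_lt_top).ne)

lemma integral_cut_le (h0 : 0 < α) (hαβ : α < β) :
    ∫ x : EuclideanSpace ℝ ι, cut α β x ≤ volume.real (closedBall (0 : EuclideanSpace ℝ ι) β) := by
  rw [← integral_indicator_one measurableSet_closedBall]
  refine integral_mono (integrable_cut h0 hαβ)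
    ((integrable_indicator_iff measurableSet_closedBall).2
      (integrableOn_const measure_closedBall_lt_top.ne)) fun x => ?_
  by_cases hx : x ∈ closedBall (0 : EuclideanSpace ℝ ι) β
  · simpa [indicator_of_mem hx] using cut_le_one x
  · rw [indicator_of_notMem hx, cut_eq_zero h0 hαβ]
    simp at hx
    exact hx.le

lemma le_integral_cut (h0 : 0 < α) (hαβ : α < β) :
    volume.real (closedBall (0 : EuclideanSpace ℝ ι) α) ≤ ∫ x : EuclideanSpace ℝ ι, cut α β x := by
  rw [← integral_indicator_one measurableSet_closedBall]
  refine integral_mono ((integrable_indicator_iff measurableSet_closedBall).2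
      (integrableOn_const measure_closedBall_lt_top.ne)) (integrable_cut h0 hαβ) fun x => ?_
  by_cases hx : x ∈ closedBall (0 : EuclideanSpace ℝ ι) α
  · rw [indicator_of_mem hx, cut_eq_one h0 hαβ (by simpa using hx)]
    simp
  · rw [indicator_of_notMem hx]
    exact cut_nonneg x

/-- A smooth nonnegative kernel of mass one supported in the ball of radius `η`. -/
structure IsMollifier (g : EuclideanSpace ℝ ι → ℝ) (η : ℝ) : Prop where
  contDiff : ContDiff ℝ ∞ g
  hasCompactSupport : HasCompactSupport g
  nonneg : ∀ y, 0 ≤ g y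
  integral_eq : ∫ y, g y = 1
  norm_lt : ∀ y, g y ≠ 0 → ‖y‖ < η

lemma exists_isMollifier {η : ℝ} (hη : 0 < η) :
    ∃ g : EuclideanSpace ℝ ι → ℝ, IsMollifier g η := by
  let f : ContDiffBump (0 : EuclideanSpace ℝ ι) := ⟨η / 2, η, by linarith, by linarith⟩
  refine ⟨f.normed volume, f.contDiff_normed, f.hasCompactSupport_normed,
    f.nonneg_normed, f.integral_normed, fun y hy => ?_⟩
  have : y ∈ Function.support (f.normed volume) := hy
  rw [f.support_normed_eq] at this
  simpa using this

lemma IsMollifier.integral_sub_left {g : EuclideanSpace ℝ ι → ℝ} {η : ℝ} (hg : IsMollifier g η)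
    (y : EuclideanSpace ℝ ι) : ∫ p, g (y - p) = 1 := by
  rw [integral_sub_left_eq_self g volume y, hg.integral_eq]

lemma IsMollifier.integral_sub_right {g : EuclideanSpace ℝ ι → ℝ} {η : ℝ} (hg : IsMollifier g η)
    (p : EuclideanSpace ℝ ι) : ∫ y, g (y - p) = 1 := by
  rw [integral_sub_right_eq_self g p, hg.integral_eq]

lemma IsMollifier.integrable {g : EuclideanSpace ℝ ι → ℝ} {η : ℝ} (hg : IsMollifier g η) :
    Integrable g :=
  hg.contDiff.continuous.integrable_of_hasCompactSupport hg.hasCompactSupport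

/-- The open spherical shell. -/
def openShell (ι : Type*) [Fintype ι] (a b : ℝ) : Set (EuclideanSpace ℝ ι) :=
  {x | a < ‖x‖ ∧ ‖x‖ < b}

lemma isOpen_openShell (a b : ℝ) : IsOpen (openShell ι a b) :=
  (isOpen_lt continuous_const continuous_norm).inter (isOpen_lt continuous_norm continuous_const)

/-- The closed spherical shell. -/
def closedShell (ι : Type*) [Fintype ι] (a b : ℝ) : Set (EuclideanSpace ℝ ι) :=
  {x | a ≤ ‖x‖ ∧ ‖x‖ ≤ b}

lemma isCompact_closedShell (a b : ℝ) : IsCompact (closedShell ι a b) := by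
  refine (isCompact_closedBall (0 : EuclideanSpace ℝ ι) b).of_isClosed_subset ?_ ?_
  · exact (isClosed_le continuous_const continuous_norm).inter
      (isClosed_le continuous_norm continuous_const)
  · intro x hx
    simpa using hx.2

lemma integrableOn_openShell {a b : ℝ} {f : EuclideanSpace ℝ ι → ℝ} (hf : Continuous f) :
    IntegrableOn f (openShell ι a b) :=
  (hf.continuousOn.integrableOn_compact (isCompact_closedShell a b)).mono_set
    fun _ hx => ⟨hx.1.le, hx.2.le⟩

lemma closedShell_nonempty [Nonempty ι] {a b : ℝ} (ha : 0 ≤ a) (hab : a ≤ b) :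
    (closedShell ι a b).Nonempty := by
  obtain ⟨x, hx⟩ := exists_norm_eq (EuclideanSpace ℝ ι) ha
  exact ⟨x, hx.ge, hx.le.trans hab⟩

lemma isPreconnected_openShell (hι : 2 ≤ Fintype.card ι) {a b : ℝ} (ha : 0 ≤ a) :
    IsPreconnected (openShell ι a b) := by
  have hrank : 1 < Module.rank ℝ (EuclideanSpace ℝ ι) := by
    rw [← Module.finrank_eq_rank, finrank_euclideanSpace]
    exact_mod_cast hι
  have h := ((isPreconnected_sphere hrank 0 1).prod (isPreconnected_Ioo (a := a) (b := b))).image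
    (fun q : EuclideanSpace ℝ ι × ℝ => q.2 • q.1) (by fun_prop)
  convert h using 1
  ext x
  constructor
  · intro hx
    have hx0 : 0 < ‖x‖ := ha.trans_lt hx.1
    refine ⟨(‖x‖⁻¹ • x, ‖x‖), ⟨?_, hx⟩, ?_⟩
    · simp [norm_smul, hx0.ne']
    · simp [smul_smul, hx0.ne']
  · rintro ⟨⟨u, s⟩, ⟨hu, hs⟩, rfl⟩
    have hu' : ‖u‖ = 1 := by simpa using hu
    have hs0 : 0 < s := ha.trans_lt hs.1
    simpa [openShell, norm_smul, hu', abs_of_pos hs0] using hs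

end Cutoff

section Degree

variable {ι : Type*} [Fintype ι] [DecidableEq ι]

/-- A smooth map into the open unit ball which restricts to a volume preserving embedding of an
open spherical shell and which preserves the integrals of the radial cutoffs of that shell. -/
structure ShellMap (Φ : EuclideanSpace ℝ ι → EuclideanSpace ℝ ι) (a b : ℝ) : Prop where
  pos : 0 < a
  contDiff : ContDiff ℝ ∞ Φ
  injOn : InjOn Φ (openShell ι a b)
  jacDet_eq : ∀ x ∈ openShell ι a b, jacDet Φ x = 1
  norm_lt : ∀ x, ‖Φ x‖ < 1
  integral_cut : ∀ α β, a < α → α < β → β < b →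
    ∫ x, cut α β x * jacDet Φ x = ∫ x : EuclideanSpace ℝ ι, cut α β x

variable {Φ : EuclideanSpace ℝ ι → EuclideanSpace ℝ ι} {a b α β α₀ β₀ η : ℝ}
  {g : EuclideanSpace ℝ ι → ℝ} {p q : EuclideanSpace ℝ ι}

namespace ShellMap

lemma isOpen_image (hΦ : ShellMap Φ a b) {T : Set (EuclideanSpace ℝ ι)} (hT : IsOpen T)
    (hTs : T ⊆ openShell ι a b) : IsOpen (Φ '' T) := by
  rw [isOpen_iff_mem_nhds]
  rintro _ ⟨x, hx, rfl⟩
  have hd := hΦ.contDiff.contDiffAt.hasStrictFDerivAt (x := x) (by simp)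
  have hdet : (fderiv ℝ Φ x).det ≠ 0 := by
    rw [det_fderiv_eq_jacDet hΦ.contDiff, hΦ.jacDet_eq x (hTs hx)]
    exact one_ne_zero
  have hr : (fderiv ℝ Φ x).range = ⊤ :=
    (LinearMap.isUnit_iff_range_eq_top _).1
      ((LinearMap.isUnit_iff_isUnit_det _).2 (isUnit_iff_ne_zero.2 hdet))
  rw [← hd.map_nhds_eq_of_surj hr]
  exact image_mem_map (hT.mem_nhds hx)

lemma setIntegral_comp (hΦ : ShellMap Φ a b) {T : Set (EuclideanSpace ℝ ι)} (hT : MeasurableSet T)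
    (hTs : T ⊆ openShell ι a b) (f : EuclideanSpace ℝ ι → ℝ) :
    ∫ x in T, f (Φ x) = ∫ y in Φ '' T, f y := by
  rw [integral_image_eq_integral_abs_det_fderiv_smul volume hT
    (fun x _ => ((hΦ.contDiff.differentiable (by simp)) x).hasFDerivAt.hasFDerivWithinAt)
    (hΦ.injOn.mono hTs)]
  refine setIntegral_congr_fun hT fun x hx => ?_
  simp [det_fderiv_eq_jacDet hΦ.contDiff, hΦ.jacDet_eq x (hTs hx)]

lemma integrable_degreeAvg (hΦ : ShellMap Φ a b) (hg : IsMollifier g η) (h0 : 0 < α)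
    (hαβ : α < β) (p : EuclideanSpace ℝ ι) :
    Integrable fun x => cut α β x * g (Φ x - p) * jacDet Φ x := by
  have h1 := (contDiff_cut (ι := ι) α β).continuous
  have h2 := hg.contDiff.continuous
  have h3 := (contDiff_jacDet hΦ.contDiff).continuous
  have h4 := hΦ.contDiff.continuous
  refine (by fun_prop : Continuous _).integrable_of_hasCompactSupport ?_
  exact (hasCompactSupport_cut h0 hαβ).mul_right.mul_right

/-- The difference of two mollified degrees is an integral over the shell. -/
lemma degreeAvg_sub (hΦ : ShellMap Φ a b) (hg : IsMollifier g η) (h1 : a < α) (h2 : α < β)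
    (h3 : β < b) (h1' : a < α₀) (h2' : α₀ < β₀) (h3' : β₀ < b) (p : EuclideanSpace ℝ ι) :
    degreeAvg Φ (cut α β) g p - degreeAvg Φ (cut α₀ β₀) g p =
      ∫ x in openShell ι a b, (cut α β x - cut α₀ β₀ x) * g (Φ x - p) := by
  have ha := hΦ.pos
  unfold degreeAvg
  rw [← integral_sub (hΦ.integrable_degreeAvg hg (ha.trans h1) h2 p)
    (hΦ.integrable_degreeAvg hg (ha.trans h1') h2' p),
    ← setIntegral_eq_integral_of_forall_compl_eq_zero (s := openShell ι a b)]
  · refine setIntegral_congr_fun (isOpen_openShell a b).measurableSet fun x hx => ?_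
    simp only [hΦ.jacDet_eq x hx]
    ring
  · intro x hx
    have : cut α β x = cut α₀ β₀ x := by
      by_cases hxa : a < ‖x‖
      · have hxb : b ≤ ‖x‖ := by
          by_contra hcon
          exact hx ⟨hxa, not_le.1 hcon⟩
        rw [cut_eq_zero (ha.trans h1) h2 (h3.le.trans hxb),
          cut_eq_zero (ha.trans h1') h2' (h3'.le.trans hxb)]
      · rw [not_lt] at hxa
        rw [cut_eq_one (ha.trans h1) h2 (hxa.trans h1.le),
          cut_eq_one (ha.trans h1') h2' (hxa.trans h1'.le)]
    rw [this, sub_self]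

lemma setIntegral_mollifier_le (hΦ : ShellMap Φ a b) (hg : IsMollifier g η)
    (p : EuclideanSpace ℝ ι) : ∫ x in openShell ι a b, g (Φ x - p) ≤ 1 := by
  rw [hΦ.setIntegral_comp (isOpen_openShell a b).measurableSet subset_rfl (fun y => g (y - p)),
    ← hg.integral_sub_right p]
  exact setIntegral_le_integral (hg.integrable.comp_sub_right p)
    (Eventually.of_forall fun y => hg.nonneg _)

lemma degreeAvg_sub_mem (hΦ : ShellMap Φ a b) (hg : IsMollifier g η) (h1 : a < α₀) (h2 : α₀ < β₀)
    (h3 : β₀ ≤ α) (h4 : α < β) (h5 : β < b) (p : EuclideanSpace ℝ ι) :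
    0 ≤ degreeAvg Φ (cut α β) g p - degreeAvg Φ (cut α₀ β₀) g p ∧
      degreeAvg Φ (cut α β) g p - degreeAvg Φ (cut α₀ β₀) g p ≤ 1 := by
  have ha := hΦ.pos
  rw [hΦ.degreeAvg_sub hg (by linarith) h4 h5 h1 h2 (by linarith) p]
  have hle : ∀ x : EuclideanSpace ℝ ι, 0 ≤ cut α β x - cut α₀ β₀ x := by
    intro x
    rcases le_total ‖x‖ α with hx | hx
    · rw [cut_eq_one (by linarith) h4 hx]
      linarith [cut_le_one (α := α₀) (β := β₀) x]
    · rw [cut_eq_zero (by linarith : 0 < α₀) h2 (h3.trans hx), sub_zero]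
      exact cut_nonneg x
  have c1 := (contDiff_cut (ι := ι) α β).continuous
  have c2 := hg.contDiff.continuous
  have c3 := (contDiff_cut (ι := ι) α₀ β₀).continuous
  have c4 := hΦ.contDiff.continuous
  refine ⟨integral_nonneg fun x => mul_nonneg (hle x) (hg.nonneg _), ?_⟩
  refine le_trans (integral_mono (integrableOn_openShell (by fun_prop))
    (integrableOn_openShell (f := fun x => g (Φ x - p)) (by fun_prop)) fun x => ?_)
    (hΦ.setIntegral_mollifier_le hg p)
  refine mul_le_of_le_one_left (hg.nonneg _) ?_
  linarith [cut_le_one (α := α) (β := β) x, cut_nonneg (α := α₀) (β := β₀) x]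

lemma fderiv_degreeAvg (hΦ : ShellMap Φ a b) (hg : IsMollifier g η) (h0 : 0 < α) (hαβ : α < β)
    (hp : ∀ x ∈ closedShell ι α β, η ≤ dist (Φ x) p) :
    fderiv ℝ (degreeAvg Φ (cut α β) g) p = 0 := by
  refine fderiv_degreeAvg_eq_zero hΦ.contDiff (contDiff_cut α β) (hasCompactSupport_cut h0 hαβ)
    hg.contDiff hg.hasCompactSupport fun x j => ?_
  by_cases hx : α ≤ ‖x‖ ∧ ‖x‖ ≤ β
  · have h1 : g (Φ x - p) = 0 := by
      by_contra h2
      have := hg.norm_lt _ h2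
      rw [← dist_eq_norm] at this
      exact (hp x hx).not_gt this
    rw [h1, zero_mul]
  · rw [partialD_cut_eq_zero h0 hαβ hx, mul_zero]

lemma differentiable_degreeAvg (hΦ : ShellMap Φ a b) (hg : IsMollifier g η) (h0 : 0 < α)
    (hαβ : α < β) : Differentiable ℝ (degreeAvg Φ (cut α β) g) := fun p =>
  (hasFDerivAt_degreeAvg hΦ.contDiff (contDiff_cut α β) (hasCompactSupport_cut h0 hαβ)
    hg.contDiff hg.hasCompactSupport p).differentiableAt

lemma degreeAvg_eq_of_convex (hΦ : ShellMap Φ a b) (hg : IsMollifier g η) (h0 : 0 < α)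
    (hαβ : α < β) {W : Set (EuclideanSpace ℝ ι)} (hW : Convex ℝ W)
    (hWη : ∀ z ∈ W, ∀ x ∈ closedShell ι α β, η ≤ dist (Φ x) z) (hp : p ∈ W) (hq : q ∈ W) :
    degreeAvg Φ (cut α β) g p = degreeAvg Φ (cut α β) g q := by
  have := hW.norm_image_sub_le_of_norm_fderiv_le (C := 0)
    (fun z _ => hΦ.differentiable_degreeAvg hg h0 hαβ z)
    (fun z hz => by rw [hΦ.fderiv_degreeAvg hg h0 hαβ (hWη z hz), norm_zero]) hq hp
  rw [zero_mul, norm_le_zero_iff, sub_eq_zero] at this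
  exact this

/-- The mollified degree is constant on the image of a shell not meeting the shell of the
cutoff. -/
lemma degreeAvg_eq_of_mem_image (hΦ : ShellMap Φ a b) (hι : 2 ≤ Fintype.card ι)
    (hg : IsMollifier g η) (h0 : 0 < α₀) (hαβ : α₀ < β₀) {s t : ℝ} (hs : 0 ≤ s)
    (hη : ∀ x ∈ closedShell ι α₀ β₀, ∀ z ∈ openShell ι s t, η ≤ dist (Φ x) (Φ z)) :
    ∃ c, ∀ p ∈ Φ '' openShell ι s t, degreeAvg Φ (cut α₀ β₀) g p = c := by
  have hD := hΦ.differentiable_degreeAvg hg h0 hαβ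
  have hΦd := hΦ.contDiff.differentiable (by simp)
  obtain ⟨c, hc⟩ := (isOpen_openShell (ι := ι) s t).exists_is_const_of_fderiv_eq_zero
    (𝕜 := ℝ) (f := degreeAvg Φ (cut α₀ β₀) g ∘ Φ) (isPreconnected_openShell hι hs)
    (hD.comp hΦd).differentiableOn (fun z hz => by
      rw [fderiv_comp z (hD _) (hΦd z),
        hΦ.fderiv_degreeAvg hg h0 hαβ fun x hx => hη x hx z hz]
      simp)
  refine ⟨c, ?_⟩
  rintro _ ⟨z, hz, rfl⟩
  exact hc z hz

/-- Crossing the image of a shell either changes the mollified degree by one or not at all. -/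
lemma degreeAvg_sub_eq_zero_or_one (hΦ : ShellMap Φ a b) (hg : IsMollifier g η)
    {s t : ℝ} (h1 : a < α₀) (h2 : α₀ < β₀) (h3 : β₀ < s) (h4 : s < α) (h5 : α < β) (h6 : β < t)
    (h7 : t < b) (hp : ball p η ⊆ Φ '' openShell ι s t)
    (hp' : ∀ x ∈ closedShell ι α β, η ≤ dist (Φ x) p) :
    degreeAvg Φ (cut α β) g p - degreeAvg Φ (cut α₀ β₀) g p = 0 ∨
      degreeAvg Φ (cut α β) g p - degreeAvg Φ (cut α₀ β₀) g p = 1 := by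
  have ha := hΦ.pos
  rw [hΦ.degreeAvg_sub hg (by linarith) h5 (by linarith) h1 h2 (by linarith) p]
  have hs1 : openShell ι s α ⊆ openShell ι a b := fun x hx =>
    ⟨by linarith [hx.1], by linarith [hx.2]⟩
  have hs2 : openShell ι β t ⊆ openShell ι a b := fun x hx =>
    ⟨by linarith [hx.1], by linarith [hx.2]⟩
  have hcov : ball p η ⊆ Φ '' openShell ι s α ∪ Φ '' openShell ι β t := by
    intro y hy
    obtain ⟨x, hx, rfl⟩ := hp hy
    by_cases hxα : ‖x‖ < α
    · exact Or.inl ⟨x, ⟨hx.1, hxα⟩, rfl⟩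
    · by_cases hxβ : β < ‖x‖
      · exact Or.inr ⟨x, ⟨hxβ, hx.2⟩, rfl⟩
      · exact absurd (hp' x ⟨not_lt.1 hxα, not_lt.1 hxβ⟩) (not_le.2 hy)
  have hdisj : Disjoint (Φ '' openShell ι s α) (Φ '' openShell ι β t) := by
    rw [disjoint_left]
    rintro _ ⟨x, hx, rfl⟩ ⟨z, hz, hzx⟩
    have := hΦ.injOn (hs2 hz) (hs1 hx) hzx
    rw [this] at hz
    linarith [hx.2, hz.1]
  have hmem : ∀ x, g (Φ x - p) ≠ 0 → Φ x ∈ ball p η := fun x hx => by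
    have := hg.norm_lt _ hx
    rwa [← dist_eq_norm] at this
  rcases isPreconnected_ball.subset_or_subset (hΦ.isOpen_image (isOpen_openShell s α) hs1)
    (hΦ.isOpen_image (isOpen_openShell β t) hs2) hdisj hcov with hsub | hsub
  · right
    have e1 : ∫ x in openShell ι a b, (cut α β x - cut α₀ β₀ x) * g (Φ x - p) =
        ∫ x in openShell ι a b, g (Φ x - p) := by
      refine setIntegral_congr_fun (isOpen_openShell a b).measurableSet fun x hx => ?_
      by_cases h0 : g (Φ x - p) = 0
      · simp [h0]
      · obtain ⟨z, hz, hzx⟩ := hsub (hmem x h0)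
        rw [hΦ.injOn (hs1 hz) hx hzx] at hz
        rw [cut_eq_one (by linarith) h5 hz.2.le,
          cut_eq_zero (by linarith) h2 (by linarith [hz.1]), sub_zero, one_mul]
    rw [e1, hΦ.setIntegral_comp (isOpen_openShell a b).measurableSet subset_rfl
      (fun y => g (y - p)), ← hg.integral_sub_right p]
    refine setIntegral_eq_integral_of_forall_compl_eq_zero fun y hy => ?_
    by_contra h0
    have h1 := hg.norm_lt _ h0
    rw [← dist_eq_norm] at h1
    exact hy ((image_mono hs1) (hsub h1))
  · left
    refine setIntegral_eq_zero_of_forall_eq_zero fun x hx => ?_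
    by_cases h0 : g (Φ x - p) = 0
    · simp [h0]
    · obtain ⟨z, hz, hzx⟩ := hsub (hmem x h0)
      rw [hΦ.injOn (hs2 hz) hx hzx] at hz
      rw [cut_eq_zero (by linarith) h5 hz.1.le,
        cut_eq_zero (by linarith) h2 (by linarith [hz.1])]
      ring

end ShellMap

end Degree

section DegreeDichotomy

lemma exists_le_dist_of_disjoint {X : Type*} [PseudoMetricSpace X] {K C : Set X}
    (hK : IsCompact K) (hC : IsClosed C) (hKC : Disjoint K C) :
    ∃ δ > 0, ∀ x ∈ K, ∀ y ∈ C, δ ≤ dist x y := by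
  obtain ⟨δ, hδ, h⟩ := hK.exists_thickening_subset_open hC.isOpen_compl
    (subset_compl_iff_disjoint_right.2 hKC)
  refine ⟨δ, hδ, fun x hx y hy => ?_⟩
  by_contra! hlt
  exact h (mem_thickening_iff.2 ⟨x, hx, by rwa [dist_comm]⟩) hy

variable {ι : Type*} [Fintype ι] [DecidableEq ι]
variable {Φ : EuclideanSpace ℝ ι → EuclideanSpace ℝ ι} {a b α β η : ℝ}
  {g : EuclideanSpace ℝ ι → ℝ} {p : EuclideanSpace ℝ ι}

namespace ShellMap

lemma integral_degreeAvg (hΦ : ShellMap Φ a b) (hg : IsMollifier g η) (h1 : a < α) (h2 : α < β)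
    (h3 : β < b) :
    ∫ p, degreeAvg Φ (cut α β) g p = ∫ x : EuclideanSpace ℝ ι, cut α β x := by
  have ha := hΦ.pos
  have c1 := (contDiff_cut (ι := ι) α β).continuous
  have c2 := hg.contDiff.continuous
  have c3 := (contDiff_jacDet hΦ.contDiff).continuous
  have c4 := hΦ.contDiff.continuous
  unfold degreeAvg
  rw [integral_integral_swap_of_hasCompactSupport
    (f := fun p x => cut α β x * g (Φ x - p) * jacDet Φ x)]
  · rw [← hΦ.integral_cut α β h1 h2 h3]
    refine integral_congr_ae (Eventually.of_forall fun x => ?_)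
    simp only
    rw [integral_mul_const, integral_const_mul, hg.integral_sub_left, mul_one]
  · unfold Function.uncurry
    fun_prop
  · refine HasCompactSupport.intro ((isCompact_closedBall (0 : EuclideanSpace ℝ ι) (1 + η)).prod
      (isCompact_closedBall (0 : EuclideanSpace ℝ ι) β)) ?_
    rintro ⟨p, x⟩ hpx
    by_contra hne
    simp only [Function.uncurry, mul_ne_zero_iff] at hne
    refine hpx ⟨?_, ?_⟩
    · rw [mem_closedBall_zero_iff]
      have e1 := hg.norm_lt _ hne.1.2
      have e2 := hΦ.norm_lt x
      have e3 := norm_sub_norm_le p (Φ x)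
      rw [norm_sub_rev] at e3
      linarith
    · rw [mem_closedBall_zero_iff]
      by_contra hx
      exact hne.1.1 (cut_eq_zero (ha.trans h1) h2 (not_le.1 hx).le)

lemma degreeAvg_eq_zero_of_two_le (hΦ : ShellMap Φ a b) (hg : IsMollifier g η) (hη : η ≤ 1)
    (χ : EuclideanSpace ℝ ι → ℝ) (hp : 2 ≤ ‖p‖) : degreeAvg Φ χ g p = 0 := by
  unfold degreeAvg
  refine integral_eq_zero_of_ae (Eventually.of_forall fun x => ?_)
  have : g (Φ x - p) = 0 := by
    by_contra hne
    have e1 := hg.norm_lt _ hne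
    have e2 := hΦ.norm_lt x
    have e3 := norm_sub_norm_le p (Φ x)
    rw [norm_sub_rev] at e3
    linarith
  simp [this]

/-- Away from the image of the shell of the cutoff, the mollified degree is one of two
consecutive values. -/
lemma degreeAvg_eq_or_eq_add_one [Nonempty ι] (hΦ : ShellMap Φ a b) (hg : IsMollifier g η)
    (hη : 0 < η)
    {α₀ β₀ s t c : ℝ} (h1 : a < α₀) (h2 : α₀ < β₀) (h3 : β₀ < s) (h4 : s < α) (h5 : α < β)
    (h6 : β < t) (h7 : t < b)
    (hthick : thickening (3 * η) (Φ '' closedShell ι α β) ⊆ Φ '' openShell ι s t)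
    (hc : ∀ p ∈ Φ '' openShell ι s t, degreeAvg Φ (cut α₀ β₀) g p = c)
    (hp : ∀ x ∈ closedShell ι α β, η ≤ dist (Φ x) p) :
    degreeAvg Φ (cut α β) g p = c ∨ degreeAvg Φ (cut α β) g p = c + 1 := by
  have ha := hΦ.pos
  have hK : IsCompact (Φ '' closedShell ι α β) :=
    (isCompact_closedShell α β).image hΦ.contDiff.continuous
  obtain ⟨k, hkK, hk⟩ := hK.exists_infDist_eq_dist
    ((closedShell_nonempty (by linarith) h5.le).image Φ) p
  have hdist : ∀ x ∈ closedShell ι α β, dist p k ≤ dist p (Φ x) := fun x hx =>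
    hk ▸ infDist_le_dist_of_mem (mem_image_of_mem Φ hx)
  have hd : η ≤ dist p k := by
    obtain ⟨x, hx, rfl⟩ := hkK
    rw [dist_comm]
    exact hp x hx
  set d := dist p k with hd_def
  have hd0 : 0 < d := hη.trans_le hd
  set m := min d (3 / 2 * η) with hm
  have hmη : η ≤ m := le_min hd (by linarith)
  have hmd : m ≤ d := min_le_left _ _
  have hm3 : m ≤ 3 / 2 * η := min_le_right _ _
  set q := AffineMap.lineMap k p (m / d) with hq
  have hqk : dist q k = m := by
    rw [hq, dist_lineMap_left, Real.norm_of_nonneg (by positivity), dist_comm k p, ← hd_def]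
    field_simp
  have hqp : dist q p = d - m := by
    rw [hq, dist_lineMap_right, Real.norm_of_nonneg (by
      rw [sub_nonneg]; exact div_le_one_of_le₀ hmd hd0.le), dist_comm k p, ← hd_def]
    field_simp
  have hseg : ∀ z ∈ segment ℝ q p, ∀ x ∈ closedShell ι α β, m ≤ dist (Φ x) z := by
    intro z hz x hx
    have hz' : z ∈ closedBall p (d - m) :=
      (convex_closedBall p (d - m)).segment_subset (by rw [mem_closedBall, hqp])
        (mem_closedBall_self (by linarith)) hz
    have e1 := hdist x hx
    have e2 := dist_triangle p z (Φ x)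
    rw [mem_closedBall, dist_comm] at hz'
    rw [dist_comm]
    linarith
  have hpq : degreeAvg Φ (cut α β) g p = degreeAvg Φ (cut α β) g q :=
    hΦ.degreeAvg_eq_of_convex hg (by linarith) h5 (convex_segment q p)
      (fun z hz x hx => hmη.trans (hseg z hz x hx)) (right_mem_segment ℝ q p)
      (left_mem_segment ℝ q p)
  have hball : ball q η ⊆ Φ '' openShell ι s t := by
    intro y hy
    refine hthick (mem_thickening_iff.2 ⟨k, hkK, ?_⟩)
    have := dist_triangle y q k
    rw [mem_ball] at hy
    linarith
  rw [hpq, ← hc q (hball (mem_ball_self hη))]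
  rcases hΦ.degreeAvg_sub_eq_zero_or_one hg h1 h2 h3 h4 h5 h6 h7 hball
    (fun x hx => hmη.trans (hseg q (left_mem_segment ℝ q p) x hx)) with h | h
  · left; linarith
  · right; linarith

/-- The mollified degree of a shell map takes values in `[0, 1]`, vanishes outside the unit ball,
and is constantly `0` or `1` on convex sets avoiding the image of the shell. -/
theorem exists_degree (hΦ : ShellMap Φ a b) (hι : 2 ≤ Fintype.card ι) (h1 : a < α) (h2 : α < β)
    (h3 : β < b) :
    ∃ η₀ > 0, ∀ η g, 0 < η → η < η₀ → IsMollifier g η →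
      (∀ p, 0 ≤ degreeAvg Φ (cut α β) g p) ∧ (∀ p, degreeAvg Φ (cut α β) g p ≤ 1) ∧
      (∀ p, 1 ≤ ‖p‖ → degreeAvg Φ (cut α β) g p = 0) ∧
      ∀ H : Set (EuclideanSpace ℝ ι), Convex ℝ H → (∀ x ∈ openShell ι a b, Φ x ∉ H) →
        (∀ p ∈ H, degreeAvg Φ (cut α β) g p = 0) ∨ ∀ p ∈ H, degreeAvg Φ (cut α β) g p = 1 := by
  have ha := hΦ.pos
  have : Nonempty ι := Fintype.card_pos_iff.1 (by omega)
  obtain ⟨s, hs1, hs2⟩ := exists_between h1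
  obtain ⟨β₀, hβ1, hβ2⟩ := exists_between hs1
  obtain ⟨α₀, hα1, hα2⟩ := exists_between hβ1
  obtain ⟨t, ht1, ht2⟩ := exists_between h3
  have hΦc := hΦ.contDiff.continuous
  have hK : IsCompact (Φ '' closedShell ι α β) := (isCompact_closedShell α β).image hΦc
  have hst : openShell ι s t ⊆ openShell ι a b := fun x hx =>
    ⟨by linarith [hx.1], by linarith [hx.2]⟩
  have hopen := hΦ.isOpen_image (isOpen_openShell s t) hst
  obtain ⟨δ, hδ, hKδ⟩ := hK.exists_thickening_subset_open
    (hopen.inter (isOpen_ball (x := (0 : EuclideanSpace ℝ ι)) (ε := 1))) (by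
      rintro _ ⟨x, hx, rfl⟩
      exact ⟨⟨x, ⟨by linarith [hx.1], by linarith [hx.2]⟩, rfl⟩,
        mem_ball_zero_iff.2 (hΦ.norm_lt x)⟩)
  obtain ⟨η₁, hη₁, hsep⟩ := exists_le_dist_of_disjoint
    ((isCompact_closedShell (ι := ι) α₀ β₀).image hΦc)
    ((isCompact_closedShell (ι := ι) s t).image hΦc).isClosed (by
      rw [disjoint_left]
      rintro _ ⟨x, hx, rfl⟩ ⟨z, hz, hzx⟩
      have := hΦ.injOn (⟨by linarith [hz.1], by linarith [hz.2]⟩ : z ∈ openShell ι a b)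
        (⟨by linarith [hx.1], by linarith [hx.2]⟩ : x ∈ openShell ι a b) hzx
      rw [this] at hz
      linarith [hz.1, hx.2])
  refine ⟨min (δ / 3) (min η₁ 1), by positivity, fun η g hη hηlt hg => ?_⟩
  have hη3 : 3 * η ≤ δ := by linarith [hηlt.trans_le (min_le_left _ _)]
  have hη1 : η ≤ η₁ := (hηlt.trans_le ((min_le_right _ _).trans (min_le_left _ _))).le
  have hη1' : η ≤ 1 := (hηlt.trans_le ((min_le_right _ _).trans (min_le_right _ _))).le
  have hthick := (thickening_mono hη3 (Φ '' closedShell ι α β)).trans hKδ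
  obtain ⟨c, hc⟩ := hΦ.degreeAvg_eq_of_mem_image hι hg (by linarith : 0 < α₀) hα2
    (by linarith : 0 ≤ s) (t := t) (fun x hx z hz => hη1.trans (hsep _ ⟨x, hx, rfl⟩ _
      ⟨z, ⟨hz.1.le, hz.2.le⟩, rfl⟩))
  have hdich : ∀ p, (∀ x ∈ closedShell ι α β, η ≤ dist (Φ x) p) →
      degreeAvg Φ (cut α β) g p = c ∨ degreeAvg Φ (cut α β) g p = c + 1 := fun p hp =>
    hΦ.degreeAvg_eq_or_eq_add_one hg hη hα1 hα2 hβ2 hs2 h2 ht1 ht2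
      (hthick.trans inter_subset_left) hc hp
  have haway : ∀ p, p ∉ thickening (3 * η) (Φ '' closedShell ι α β) →
      ∀ x ∈ closedShell ι α β, η ≤ dist (Φ x) p := by
    intro p hp x hx
    by_contra! hlt
    refine hp (mem_thickening_iff.2 ⟨Φ x, mem_image_of_mem Φ hx, ?_⟩)
    rw [dist_comm]
    linarith
  have hout : ∀ p : EuclideanSpace ℝ ι, 1 ≤ ‖p‖ →
      p ∉ thickening (3 * η) (Φ '' closedShell ι α β) := fun p hp hmem =>
    (mem_ball_zero_iff.1 (hthick hmem).2).not_ge hp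
  have hbd : ∀ p, c ≤ degreeAvg Φ (cut α β) g p ∧ degreeAvg Φ (cut α β) g p ≤ c + 1 := by
    intro p
    by_cases hp : p ∈ thickening (3 * η) (Φ '' closedShell ι α β)
    · have e := hΦ.degreeAvg_sub_mem hg hα1 hα2 (by linarith : β₀ ≤ α) h2 h3 p
      rw [hc p (hthick hp).1] at e
      constructor <;> linarith [e.1, e.2]
    · rcases hdich p (haway p hp) with h | h <;> rw [h] <;> constructor <;> linarith
  have hc0 : c = 0 := by
    obtain ⟨p, hp⟩ := exists_norm_eq (EuclideanSpace ℝ ι) (zero_le_two (α := ℝ))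
    have h0 := hdich p (haway p (hout p (by linarith)))
    rw [hΦ.degreeAvg_eq_zero_of_two_le hg hη1' _ hp.ge] at h0
    rcases h0 with h0 | h0
    · exact h0.symm
    · have hneg : ∫ p, degreeAvg Φ (cut α β) g p ≤ 0 :=
        integral_nonpos fun p => by have := (hbd p).2; simp only [Pi.zero_apply]; linarith
      rw [hΦ.integral_degreeAvg hg h1 h2 h3] at hneg
      have hpos : 0 < volume.real (closedBall (0 : EuclideanSpace ℝ ι) α) :=
        ENNReal.toReal_pos (measure_closedBall_pos _ _ (ha.trans h1)).ne'
          measure_closedBall_lt_top.ne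
      linarith [le_integral_cut (ι := ι) (ha.trans h1) h2]
  subst hc0
  simp only [zero_add] at hbd hdich
  refine ⟨fun p => (hbd p).1, fun p => (hbd p).2, fun p hp => ?_, fun H hH hHΦ => ?_⟩
  · have h2p : 2 ≤ ‖(2 : ℝ) • p‖ := by
      rw [norm_smul, Real.norm_ofNat]
      linarith
    rw [← hΦ.degreeAvg_eq_zero_of_two_le hg hη1' (cut α β) h2p]
    refine hΦ.degreeAvg_eq_of_convex hg (ha.trans h1) h2 (convex_segment p ((2 : ℝ) • p))
      (fun z hz => haway z (hout z ?_)) (left_mem_segment ℝ _ _) (right_mem_segment ℝ _ _)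
    obtain ⟨u, v, hu, hv, huv, rfl⟩ := hz
    rw [smul_smul, ← add_smul, norm_smul, Real.norm_of_nonneg (by positivity)]
    nlinarith
  · have hHaway : ∀ z ∈ H, ∀ x ∈ closedShell ι α β, η ≤ dist (Φ x) z := by
      intro z hz
      refine haway z fun hmem => ?_
      obtain ⟨x, hx, rfl⟩ := (hthick hmem).1
      exact hHΦ x (hst hx) hz
    rcases H.eq_empty_or_nonempty with rfl | ⟨q, hq⟩
    · simp
    · have hconst : ∀ p ∈ H, degreeAvg Φ (cut α β) g p = degreeAvg Φ (cut α β) g q :=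
        fun p hp => hΦ.degreeAvg_eq_of_convex hg (ha.trans h1) h2 hH hHaway hp hq
      rcases hdich q (hHaway q hq) with h | h
      · exact Or.inl fun p hp => (hconst p hp).trans h
      · exact Or.inr fun p hp => (hconst p hp).trans h

end ShellMap

end DegreeDichotomy

section Obstruction

variable {ι : Type*} [Fintype ι] [DecidableEq ι]
variable {Φ : EuclideanSpace ℝ ι → EuclideanSpace ℝ ι} {a b α β η t : ℝ}
  {g : EuclideanSpace ℝ ι → ℝ}

namespace ShellMap

lemma integrable_degreeAvg_self (hΦ : ShellMap Φ a b) (hg : IsMollifier g η) (h1 : a < α)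
    (h2 : α < β) (hout : ∀ p, 1 ≤ ‖p‖ → degreeAvg Φ (cut α β) g p = 0) :
    Integrable (degreeAvg Φ (cut α β) g) :=
  (hΦ.differentiable_degreeAvg hg (hΦ.pos.trans h1) h2).continuous.integrable_of_hasCompactSupport
    (hasCompactSupport_of_norm_gt 1 fun p hp => hout p hp.le)

/-- A shell map has outer radius at most one. -/
lemma radius_le_one (hΦ : ShellMap Φ a b) (hι : 2 ≤ Fintype.card ι) (h1 : a < α) (h3 : α < b) :
    α ≤ 1 := by
  obtain ⟨β, h2, h3⟩ := exists_between h3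
  have ha := hΦ.pos
  obtain ⟨η₀, hη₀, h⟩ := hΦ.exists_degree hι h1 h2 h3
  obtain ⟨g, hg⟩ := exists_isMollifier (ι := ι) (half_pos hη₀)
  obtain ⟨-, hle, hout, -⟩ := h _ g (half_pos hη₀) (half_lt_self hη₀) hg
  have e1 := le_integral_cut (ι := ι) (ha.trans h1) h2
  rw [← hΦ.integral_degreeAvg hg h1 h2 h3] at e1
  have e2 : ∫ p, degreeAvg Φ (cut α β) g p ≤ volume.real (closedBall (0 : EuclideanSpace ℝ ι) 1) := by
    rw [← integral_indicator_one measurableSet_closedBall]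
    refine integral_mono (hΦ.integrable_degreeAvg_self hg h1 h2 hout)
      (integrable_indicator_const measurableSet_closedBall subset_rfl) fun p => ?_
    by_cases hp : p ∈ closedBall (0 : EuclideanSpace ℝ ι) 1
    · simpa [indicator_of_mem hp] using hle p
    · rw [indicator_of_notMem hp, hout p ?_]
      simp only [mem_closedBall_zero_iff, not_le] at hp
      exact hp.le
  rw [volume_real_closedBall_eq_pow (ha.trans h1).le] at e1
  have e3 : α ^ Fintype.card ι ≤ 1 := by
    have := e1.trans e2
    have hpos := volume_real_closedBall_one_pos (ι := ι)
    nlinarith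
  by_contra! hcon
  exact e3.not_gt (one_lt_pow₀ hcon (by omega))

/-- A shell map avoiding a concentric ball which does not fit into the hole of the shell satisfies
a volume constraint. -/
theorem volume_constraint (hΦ : ShellMap Φ a b) (hι : 2 ≤ Fintype.card ι) (hat : a < t)
    (ht1 : t ≤ 1) (hH : ∀ x ∈ openShell ι a b, Φ x ∉ closedBall (0 : EuclideanSpace ℝ ι) t)
    (h1 : a < α) (h3 : α < b) :
    α ^ Fintype.card ι ≤ 1 - t ^ Fintype.card ι := by
  by_contra! hcon
  have ha := hΦ.pos
  have ht0 : 0 < t := ha.trans hat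
  have hv := volume_real_closedBall_one_pos (ι := ι)
  obtain ⟨β, h2, h3⟩ := exists_between h3
  obtain ⟨β₁, hβ1, hβ2⟩ := exists_between (lt_min hat h1)
  obtain ⟨α₁, hα1, hα2⟩ := exists_between hβ1
  have hβt := hβ2.trans_le (min_le_left _ _)
  have hβα := hβ2.trans_le (min_le_right _ _)
  obtain ⟨η₁, hη₁, hD1⟩ := hΦ.exists_degree hι hα1 hα2 (by linarith : β₁ < b)
  obtain ⟨η₂, hη₂, hD2⟩ := hΦ.exists_degree hι h1 h2 h3
  have hsub : closedShell ι α₁ β ⊆ openShell ι a b := fun x hx =>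
    ⟨by linarith [hx.1], by linarith [hx.2]⟩
  obtain ⟨η₃, hη₃, hsep⟩ := exists_le_dist_of_disjoint
    ((isCompact_closedShell (ι := ι) α₁ β).image hΦ.contDiff.continuous)
    (isClosed_closedBall (x := (0 : EuclideanSpace ℝ ι)) (ε := t)) (by
      rw [disjoint_left]
      rintro _ ⟨x, hx, rfl⟩
      exact hH x (hsub hx))
  obtain ⟨η, hη, hηlt⟩ := exists_between (lt_min hη₁ (lt_min hη₂ hη₃))
  have l1 := hηlt.trans_le (min_le_left _ _)
  have l2 := hηlt.trans_le ((min_le_right _ _).trans (min_le_left _ _))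
  have l3 := hηlt.trans_le ((min_le_right _ _).trans (min_le_right _ _))
  obtain ⟨g, hg⟩ := exists_isMollifier (ι := ι) hη
  obtain ⟨hnn1, hle1, hout1, hhole1⟩ := hD1 η g hη l1 hg
  obtain ⟨hnn2, hle2, hout2, hhole2⟩ := hD2 η g hη l2 hg
  have hbt : closedBall (0 : EuclideanSpace ℝ ι) t ⊆ closedBall 0 1 := closedBall_subset_closedBall ht1
  have z1 : ∀ p ∈ closedBall (0 : EuclideanSpace ℝ ι) t, degreeAvg Φ (cut α₁ β₁) g p = 0 := by
    rcases hhole1 _ (convex_closedBall 0 t) hH with h | h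
    · exact h
    exfalso
    have e1 : volume.real (closedBall (0 : EuclideanSpace ℝ ι) t) ≤
        ∫ p, degreeAvg Φ (cut α₁ β₁) g p := by
      rw [← integral_indicator_one measurableSet_closedBall]
      refine integral_mono (integrable_indicator_const measurableSet_closedBall hbt)
        (hΦ.integrable_degreeAvg_self hg hα1 hα2 hout1) fun p => ?_
      by_cases hp : p ∈ closedBall (0 : EuclideanSpace ℝ ι) t
      · simp [indicator_of_mem hp, h p hp]
      · rw [indicator_of_notMem hp]
        exact hnn1 p
    rw [hΦ.integral_degreeAvg hg hα1 hα2 (by linarith)] at e1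
    have e2 := integral_cut_le (ι := ι) (ha.trans hα1) hα2
    rw [volume_real_closedBall_eq_pow (by linarith)] at e1 e2
    have e3 : t ^ Fintype.card ι ≤ β₁ ^ Fintype.card ι :=
      le_of_mul_le_mul_right (e1.trans e2) hv
    exact e3.not_gt (pow_lt_pow_left₀ hβt (by linarith) (by omega))
  have z2 : ∀ p ∈ closedBall (0 : EuclideanSpace ℝ ι) t, degreeAvg Φ (cut α β) g p = 1 := by
    rcases hhole2 _ (convex_closedBall 0 t) hH with h | h
    swap
    · exact h
    exfalso
    have e1 : ∫ p, degreeAvg Φ (cut α β) g p ≤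
        volume.real (closedBall (0 : EuclideanSpace ℝ ι) 1 \ closedBall 0 t) := by
      rw [← integral_indicator_one (measurableSet_closedBall.diff measurableSet_closedBall)]
      refine integral_mono (hΦ.integrable_degreeAvg_self hg h1 h2 hout2)
        (integrable_indicator_const (measurableSet_closedBall.diff measurableSet_closedBall)
          sdiff_subset) fun p => ?_
      by_cases hp : p ∈ closedBall (0 : EuclideanSpace ℝ ι) 1 \ closedBall 0 t
      · simpa [indicator_of_mem hp] using hle2 p
      · rw [indicator_of_notMem hp]
        by_cases hpt : p ∈ closedBall (0 : EuclideanSpace ℝ ι) t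
        · exact (h p hpt).le
        · refine (hout2 p ?_).le
          by_contra! hlt
          exact hp ⟨mem_closedBall_zero_iff.2 hlt.le, hpt⟩
    rw [measureReal_sdiff hbt measurableSet_closedBall measure_closedBall_lt_top.ne,
      hΦ.integral_degreeAvg hg h1 h2 h3] at e1
    have e2 := le_integral_cut (ι := ι) (ha.trans h1) h2
    rw [volume_real_closedBall_eq_pow (r := t) ht0.le] at e1
    rw [volume_real_closedBall_eq_pow (by linarith)] at e2
    have e3 := e2.trans e1
    nlinarith
  have h0 : (0 : EuclideanSpace ℝ ι) ∈ closedBall (0 : EuclideanSpace ℝ ι) t := by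
    simpa using ht0.le
  have hdiff := hΦ.degreeAvg_sub hg h1 h2 h3 hα1 hα2 (by linarith) 0
  rw [z1 0 h0, z2 0 h0, setIntegral_eq_zero_of_forall_eq_zero] at hdiff
  · norm_num at hdiff
  intro x _
  by_cases hx : x ∈ closedShell ι α₁ β
  · have : g (Φ x - 0) = 0 := by
      by_contra hne
      have e1 := hg.norm_lt _ hne
      rw [← dist_eq_norm] at e1
      linarith [hsep _ (mem_image_of_mem Φ hx) 0 h0]
    rw [this, mul_zero]
  · have : cut α β x = cut α₁ β₁ x := by
      by_cases hxα : α₁ ≤ ‖x‖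
      · have hxβ : β < ‖x‖ := by
          by_contra hc
          exact hx ⟨hxα, not_lt.1 hc⟩
        rw [cut_eq_zero (by linarith) h2 hxβ.le, cut_eq_zero (by linarith) hα2 (by linarith)]
      · rw [not_le] at hxα
        rw [cut_eq_one (by linarith) h2 (by linarith), cut_eq_one (by linarith) hα2 hxα.le]
    rw [this, sub_self, zero_mul]

end ShellMap

end Obstruction

section ShellCapacity

variable {n : ℕ}

/-- A symplectic embedding of a closed shell restricts, on a smaller shell, to a globally defined
shell map. -/
lemma exists_shellMap (hn : 2 ≤ n) {N U : Set (R2n n)} {φ : R2n n → R2n n}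
    (hφ : IsSympEmbOn n N U φ) (hU : U ⊆ ball 0 1) {a₀ a b b₀ : ℝ} (ha₀ : 0 < a₀) (h1 : a₀ < a)
    (h2 : a < b) (h3 : b < b₀) (hN : ∀ x, a₀ ≤ ‖x‖ → ‖x‖ ≤ b₀ → x ∈ N) :
    ∃ Φ, ShellMap Φ a b ∧ ∀ x ∈ openShell (Fin (2 * n)) a b, Φ x = φ x := by
  obtain ⟨hNo, hφs, hφi, hφm, hφω⟩ := hφ
  obtain ⟨a', ha1, ha2⟩ := exists_between h1
  obtain ⟨b', hb1, hb2⟩ := exists_between h3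
  set θ : R2n n → ℝ := fun x => cut b b' x - cut a' a x with hθ
  have hθs : ContDiff ℝ ∞ θ := (contDiff_cut b b').sub (contDiff_cut a' a)
  have hθ1 : ∀ x, a ≤ ‖x‖ → ‖x‖ ≤ b → θ x = 1 := fun x hx hx' => by
    simp only [hθ]
    rw [cut_eq_one (by linarith) hb1 hx', cut_eq_zero (by linarith) ha2 hx, sub_zero]
  have hθ0 : ∀ x, ‖x‖ ≤ a' → θ x = 0 := fun x hx => by
    simp only [hθ]
    rw [cut_eq_one (by linarith) hb1 (by linarith), cut_eq_one (by linarith) ha2 hx, sub_self]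
  have hθ0' : ∀ x, b' ≤ ‖x‖ → θ x = 0 := fun x hx => by
    simp only [hθ]
    rw [cut_eq_zero (by linarith) hb1 hx, cut_eq_zero (by linarith) ha2 (by linarith), sub_self]
  have hθabs : ∀ x, |θ x| ≤ 1 := fun x => by
    rw [abs_le]
    constructor
    · linarith [cut_nonneg (α := b) (β := b') x, cut_le_one (α := a') (β := a) x]
    · linarith [cut_nonneg (α := a') (β := a) x, cut_le_one (α := b) (β := b') x]
  have hΦs : ContDiff ℝ ∞ fun x => θ x • φ x := by
    rw [contDiff_iff_contDiffAt]
    intro x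
    by_cases hx1 : ‖x‖ < a'
    · refine (contDiffAt_const (c := (0 : R2n n))).congr_of_eventuallyEq ?_
      filter_upwards [(isOpen_lt continuous_norm continuous_const).mem_nhds hx1] with y hy
      simp [hθ0 y (le_of_lt hy)]
    by_cases hx2 : b' < ‖x‖
    · refine (contDiffAt_const (c := (0 : R2n n))).congr_of_eventuallyEq ?_
      filter_upwards [(isOpen_lt continuous_const continuous_norm).mem_nhds hx2] with y hy
      simp [hθ0' y (le_of_lt hy)]
    rw [not_lt] at hx1 hx2
    exact hθs.contDiffAt.smul
      (hφs.contDiffAt (hNo.mem_nhds (hN x (by linarith) (by linarith))))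
  have heq : ∀ x ∈ openShell (Fin (2 * n)) a b, θ x • φ x = φ x := fun x hx => by
    rw [hθ1 x hx.1.le hx.2.le, one_smul]
  have hsub : openShell (Fin (2 * n)) a b ⊆ N := fun x hx =>
    hN x (by linarith [hx.1]) (by linarith [hx.2])
  have hω : ∀ x ∈ openShell (Fin (2 * n)) a b, ∀ v w, sympForm n
      (fderiv ℝ (fun x => θ x • φ x) x v) (fderiv ℝ (fun x => θ x • φ x) x w) =
      sympForm n v w := by
    intro x hx v w
    have hev : (fun x => θ x • φ x) =ᶠ[𝓝 x] φ := by
      filter_upwards [(isOpen_openShell a b).mem_nhds hx] with y hy using heq y hy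
    rw [hev.fderiv_eq]
    exact hφω x (hsub hx) v w
  refine ⟨fun x => θ x • φ x, ⟨by linarith, hΦs, ?_, ?_, ?_, ?_⟩, heq⟩
  · exact (hφi.mono hsub).congr fun x hx => (heq x hx).symm
  · intro x hx
    rw [← det_fderiv_eq_jacDet hΦs]
    exact det_eq_one_of_sympForm _ (hω x hx)
  · intro x
    by_cases hx : θ x = 0
    · simp [hx]
    · have hx1 : a' ≤ ‖x‖ := by
        by_contra! hc
        exact hx (hθ0 x hc.le)
      have hx2 : ‖x‖ ≤ b' := by
        by_contra! hc
        exact hx (hθ0' x hc.le)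
      have hlt := mem_ball_zero_iff.1 (hU (hφm (hN x (by linarith) (by linarith))))
      rw [norm_smul, Real.norm_eq_abs]
      exact (mul_le_of_le_one_left (norm_nonneg _) (hθabs x)).trans_lt hlt
  · intro α β hα hαβ hβ
    refine integral_radial_mul_jacDet hn hΦs (contDiff_radCut α β)
      (hasCompactSupport_cut (by linarith) hαβ)
      (hasCompactSupport_deriv_radCut (by linarith) hαβ) fun x hx => hω x ?_
    have := mem_of_deriv_radCut_ne_zero (by linarith) hαβ hx
    exact ⟨by linarith [this.1], by linarith [this.2]⟩

/-- The volume constraint on shells which embed symplectically into a thinner shell. -/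
theorem pow_le_of_sympEmbNbhd (hn : 2 ≤ n) {δ ε r : ℝ} (hε : 0 < ε) (hεδ : ε < δ) (hδ : δ < 1)
    (hr : 0 < r) (h : SympEmbNbhd n (closedBall (0 : R2n n) r \ ball 0 (r * (1 - δ)))
      (ball (0 : R2n n) 1 \ closedBall 0 (1 - ε))) :
    r ^ (2 * n) ≤ 1 - (1 - ε) ^ (2 * n) := by
  obtain ⟨N, φ, hN, hφ⟩ := h
  have hN' : ∀ x, r * (1 - δ) ≤ ‖x‖ → ‖x‖ ≤ r → x ∈ N := fun x hx hx' =>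
    hN ⟨mem_closedBall_zero_iff.2 hx', fun hmem => (mem_ball_zero_iff.1 hmem).not_ge hx⟩
  have ha₀ : 0 < r * (1 - δ) := mul_pos hr (by linarith)
  have hlt : r * (1 - δ) < r := by nlinarith
  have hι : 2 ≤ Fintype.card (Fin (2 * n)) := by simp; omega
  have hr1 : r ≤ 1 := by
    obtain ⟨a, ha1, ha2⟩ := exists_between hlt
    by_contra! hcon
    obtain ⟨α, hα1, hα2⟩ := exists_between (max_lt ha2 hcon)
    obtain ⟨b, hb1, hb2⟩ := exists_between hα2
    have haα := (le_max_left _ _).trans_lt hα1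
    obtain ⟨Φ, hΦ, -⟩ := exists_shellMap hn hφ sdiff_subset ha₀ ha1 (haα.trans hb1) hb2 hN'
    exact ((le_max_right _ _).trans_lt hα1).not_ge (hΦ.radius_le_one hι haα hb1)
  have hat : r * (1 - δ) < min (1 - ε) r := lt_min (by nlinarith) hlt
  obtain ⟨a, ha1, ha2⟩ := exists_between hat
  have hat := ha2.trans_le (min_le_left _ _)
  have har := ha2.trans_le (min_le_right _ _)
  have hlim : Tendsto (fun α : ℝ => α ^ (2 * n)) (𝓝[<] r) (𝓝 (r ^ (2 * n))) :=
    ((continuous_pow (2 * n)).tendsto r).mono_left nhdsWithin_le_nhds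
  refine le_of_tendsto hlim ?_
  filter_upwards [Ioo_mem_nhdsLT har] with α hα
  obtain ⟨b, hb1, hb2⟩ := exists_between hα.2
  obtain ⟨Φ, hΦ, hΦφ⟩ := exists_shellMap hn hφ sdiff_subset ha₀ ha1 (hα.1.trans hb1) hb2 hN'
  have key := hΦ.volume_constraint hι hat (by linarith) (fun x hx => ?_) hα.1 hb1
  · simpa using key
  · rw [hΦφ x hx]
    exact (hφ.2.2.2.1 (hN' x (by linarith [hx.1]) (by linarith [hx.2]))).2

lemma shellCap_le (hn : 2 ≤ n) {δ ε : ℝ} (hε : 0 < ε) (hεδ : ε < δ) (hδ : δ < 1) :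
    shellCap n δ (ball (0 : R2n n) 1 \ closedBall 0 (1 - ε)) ≤
      ENNReal.ofReal (π * (1 - (1 - δ) ^ (2 * n)) ^ ((n : ℝ)⁻¹)) := by
  refine sSup_le ?_
  rintro _ ⟨r, hr, rfl, h⟩
  have h1 := pow_le_of_sympEmbNbhd hn hε hεδ hδ hr h
  have h2 : (1 - δ) ^ (2 * n) ≤ (1 - ε) ^ (2 * n) :=
    pow_le_pow_left₀ (by linarith) (by linarith) _
  have h3 : (1 - δ) ^ (2 * n) ≤ 1 := pow_le_one₀ (by linarith) (by linarith)
  refine ENNReal.ofReal_le_ofReal (mul_le_mul_of_nonneg_left ?_ pi_pos.le)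
  rw [Real.le_rpow_inv_iff_of_pos (by positivity) (by linarith) (by positivity),
    Real.rpow_natCast, ← pow_mul]
  linarith

lemma le_shellCap {δ ε : ℝ} (hδε : δ < ε) (hε : ε < 1) :
    ENNReal.ofReal π ≤ shellCap n δ (ball (0 : R2n n) 1 \ closedBall 0 (1 - ε)) := by
  have hq : (1 - ε) / (1 - δ) < 1 := by
    rw [div_lt_one (by linarith)]
    linarith
  have hlim : Tendsto (fun r : ℝ => ENNReal.ofReal (π * r ^ 2)) (𝓝[<] 1)
      (𝓝 (ENNReal.ofReal (π * 1 ^ 2))) :=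
    ((ENNReal.continuous_ofReal.comp (by fun_prop : Continuous fun r : ℝ => π * r ^ 2)).tendsto
      1).mono_left nhdsWithin_le_nhds
  rw [one_pow, mul_one] at hlim
  refine le_of_tendsto hlim ?_
  filter_upwards [Ioo_mem_nhdsLT hq] with r hr
  have hr0 : 0 < r := lt_of_le_of_lt (div_nonneg (by linarith) (by linarith)) hr.1
  have hr1 : 1 - ε < r * (1 - δ) := (div_lt_iff₀ (by linarith)).1 hr.1
  refine le_sSup ⟨r, hr0, rfl, ball (0 : R2n n) 1 \ closedBall 0 (1 - ε), id, ?_,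
    isOpen_ball.sdiff isClosed_closedBall, contDiff_id.contDiffOn, injOn_id _, mapsTo_id _, ?_⟩
  · rintro x ⟨hx1, hx2⟩
    rw [mem_closedBall_zero_iff] at hx1
    rw [mem_ball_zero_iff, not_lt] at hx2
    exact ⟨mem_ball_zero_iff.2 (hx1.trans_lt hr.2), fun hmem => by
      linarith [mem_closedBall_zero_iff.1 hmem]⟩
  · intro p _ v w
    simp

end ShellCapacity

/-- Theorem 2: the `δ`-shell capacity is discontinuous at `ε = δ` on the family of open
spherical shells `U_ε = B_1 \ closure(B_(1-ε))`. -/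
theorem shell_capacity_discontinuous
    (n : ℕ) (hn : 2 ≤ n) (δ : ℝ) (hδ : δ ∈ Ioo (0 : ℝ) 1) :
    ¬ ContinuousWithinAt
        (fun ε : ℝ => shellCap n δ (ball (0 : R2n n) 1 \ closedBall 0 (1 - ε)))
        (Ioo (0 : ℝ) 1) δ := by

  intro hcont
  obtain ⟨h0, h1⟩ := hδ
  have hq : (1 - (1 - δ) ^ (2 * n)) ^ ((n : ℝ)⁻¹) < 1 := by
    have hpos : 0 < (1 - δ) ^ (2 * n) := pow_pos (by linarith) _
    have hle : (1 - δ) ^ (2 * n) ≤ 1 := pow_le_one₀ (by linarith) (by linarith)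
    have hn0 : (0 : ℝ) < n := by exact_mod_cast (by omega : 0 < n)
    exact Real.rpow_lt_one (by linarith) (by linarith) (by positivity)
  have hl : Tendsto (fun ε : ℝ => shellCap n δ (ball (0 : R2n n) 1 \ closedBall 0 (1 - ε)))
      (𝓝[<] δ) (𝓝 (shellCap n δ (ball (0 : R2n n) 1 \ closedBall 0 (1 - δ)))) := by
    refine hcont.tendsto.mono_left ?_
    rw [← nhdsWithin_Ioo_eq_nhdsLT h0]
    exact nhdsWithin_mono _ (Ioo_subset_Ioo_right h1.le)
  have hr : Tendsto (fun ε : ℝ => shellCap n δ (ball (0 : R2n n) 1 \ closedBall 0 (1 - ε)))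
      (𝓝[>] δ) (𝓝 (shellCap n δ (ball (0 : R2n n) 1 \ closedBall 0 (1 - δ)))) := by
    refine hcont.tendsto.mono_left ?_
    rw [← nhdsWithin_Ioo_eq_nhdsGT h1]
    exact nhdsWithin_mono _ (Ioo_subset_Ioo_left h0.le)
  have hupper := le_of_tendsto hl (by
    filter_upwards [Ioo_mem_nhdsLT h0] with ε hε using shellCap_le hn hε.1 hε.2 h1)
  have hlower := ge_of_tendsto hr (by
    filter_upwards [Ioo_mem_nhdsGT h1] with ε hε using le_shellCap hε.1 hε.2)
  have hlt : ENNReal.ofReal (π * (1 - (1 - δ) ^ (2 * n)) ^ ((n : ℝ)⁻¹)) < ENNReal.ofReal π := by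
    rw [ENNReal.ofReal_lt_ofReal_iff pi_pos]
    exact mul_lt_of_lt_one_right pi_pos hq
  exact (hlower.trans hupper).not_gt hlt
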